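/- arXiv:0908.3437 — 3 statements merged into one kernel-verified Lean document; each statement's English description precedes it below -/
import Mathlib

section
/- Let X₁,...,Xₙ be i.i.d. standard normal, C a family of K-subsets of {1,...,n}, and X_S = ∑_{i∈S}Xᵢ. The maximum test f(x) = 1{max_{S∈C} x_S ≥ (μK + E₀max_{S∈C}X_S)/2} satisfies R(f) ≤ δ whenever μ ≥ (E₀max_{S∈C}X_S)/K + 2√((2/K)·log(2/δ)). -/
open MeasureTheory Real Finset ProbabilityTheory

open Filter Topology in
/-- The quantile function of a continuous positive probability density. -/
theorem exists_quantile {ρ : ℝ → ℝ} (hc : Continuous ρ) (hpos : ∀ x, 0 < ρ x)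
    (hi : Integrable ρ) (h1 : ∫ x, ρ x = 1) :
    ∃ u : ℝ → ℝ, StrictMonoOn u (Set.Ioo 0 1) ∧
      ∀ p ∈ Set.Ioo (0 : ℝ) 1, HasDerivAt u (ρ (u p))⁻¹ p := by
  set G : ℝ → ℝ := fun x => ∫ t in Set.Iic x, ρ t
  have hsub : ∀ x, G x = G 0 + ∫ t in (0 : ℝ)..x, ρ t := fun x => by
    rw [← intervalIntegral.integral_Iic_sub_Iic hi.integrableOn hi.integrableOn]
    ring
  have hG : ∀ x, HasDerivAt G (ρ x) x := fun x => by
    rw [funext hsub]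
    exact ((hc.integral_hasStrictDerivAt 0 x).hasDerivAt).const_add _
  have hmono : StrictMono G := strictMono_of_hasDerivAt_pos hG hpos
  have hGc : Continuous G := continuous_iff_continuousAt.2 fun x => (hG x).continuousAt
  have htop : Tendsto G atTop (𝓝 1) := by
    have := (aecover_Iic (μ := volume) (tendsto_id (α := ℝ) (x := atTop))
      ).integral_tendsto_of_countably_generated hi
    rwa [h1] at this
  have hbot : Tendsto G atBot (𝓝 0) := by
    have h := (intervalIntegral_tendsto_integral_Iic 0 hi.integrableOn
      (tendsto_id (α := ℝ) (x := atBot))).const_sub (G 0)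
    rw [show G 0 - ∫ t in Set.Iic 0, ρ t = 0 from sub_self _] at h
    refine h.congr fun x => ?_
    rw [hsub x, intervalIntegral.integral_symm]
    simp [G]
  have hmem : ∀ x, G x ∈ Set.Ioo (0 : ℝ) 1 := fun x =>
    ⟨(hmono.monotone.le_of_tendsto hbot (x - 1)).trans_lt (hmono (by linarith)),
      (hmono (by linarith : x < x + 1)).trans_le (hmono.monotone.ge_of_tendsto htop _)⟩
  have hsurj : ∀ p : ℝ, ∃ x, p ∈ Set.Ioo (0 : ℝ) 1 → G x = p := fun p => by
    by_cases hp : p ∈ Set.Ioo (0 : ℝ) 1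
    · obtain ⟨a, ha⟩ := (hbot.eventually_lt_const hp.1).exists
      obtain ⟨b, hb⟩ := (htop.eventually_const_lt hp.2).exists
      obtain ⟨x, hx⟩ := mem_range_of_exists_le_of_exists_ge hGc ⟨a, ha.le⟩ ⟨b, hb.le⟩
      exact ⟨x, fun _ => hx⟩
    · exact ⟨0, fun h => absurd h hp⟩
  choose u hu using hsurj
  have humono : StrictMonoOn u (Set.Ioo 0 1) := fun p hp p' hp' h => by
    rw [← hmono.lt_iff_lt, hu p hp, hu p' hp']
    exact h
  have himage : u '' Set.Ioo 0 1 = Set.univ :=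
    Set.eq_univ_of_forall fun x => ⟨G x, hmem x, hmono.injective (hu _ (hmem x))⟩
  refine ⟨u, humono, fun p hp => ?_⟩
  have hnhds : Set.Ioo (0 : ℝ) 1 ∈ 𝓝 p := Ioo_mem_nhds hp.1 hp.2
  refine HasDerivAt.of_local_left_inverse (f := G) ?_ (hG _) (hpos _).ne' ?_
  · exact continuousAt_of_monotoneOn_of_image_mem_nhds humono.monotoneOn hnhds
      (by rw [himage]; exact univ_mem)
  · filter_upwards [hnhds] with y hy using hu y hy

/-- The **Prékopa–Leindler inequality** on the line, for continuous positive densities. -/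
theorem one_le_lintegral_of_prekopaLeindler {f ρ h : ℝ → ℝ} {s : ℝ} (hs : s ∈ Set.Ioo (0 : ℝ) 1)
    (hf : Continuous f) (hfpos : ∀ x, 0 < f x) (hfi : Integrable f) (hf1 : ∫ x, f x = 1)
    (hρ : Continuous ρ) (hρpos : ∀ x, 0 < ρ x) (hρi : Integrable ρ) (hρ1 : ∫ x, ρ x = 1)
    (hh : ∀ x y, f x ^ (1 - s) * ρ y ^ s ≤ h ((1 - s) * x + s * y)) :
    1 ≤ ∫⁻ x, ENNReal.ofReal (h x) := by
  obtain ⟨u, hu, hu'⟩ := exists_quantile hf hfpos hfi hf1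
  obtain ⟨v, hv, hv'⟩ := exists_quantile hρ hρpos hρi hρ1
  have hs1 : 0 < 1 - s := sub_pos.2 hs.2
  have hs0 : 0 < s := hs.1
  set z : ℝ → ℝ := fun t => (1 - s) * u t + s * v t
  set z' : ℝ → ℝ := fun t => (1 - s) * (f (u t))⁻¹ + s * (ρ (v t))⁻¹
  have hz : StrictMonoOn z (Set.Ioo 0 1) := fun a ha b hb hab => by
    have := hu ha hb hab
    have := hv ha hb hab
    simp only [z]
    gcongr
  have hz' : ∀ t ∈ Set.Ioo (0 : ℝ) 1, HasDerivWithinAt z (z' t) (Set.Ioo 0 1) t := fun t ht =>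
    (((hu' t ht).const_mul _).add ((hv' t ht).const_mul _)).hasDerivWithinAt
  have hone : ∀ t, 1 ≤ |z' t| * h (z t) := fun t => by
    have hfu := hfpos (u t)
    have hρv := hρpos (v t)
    have hamgm : (f (u t))⁻¹ ^ (1 - s) * (ρ (v t))⁻¹ ^ s ≤ z' t :=
      Real.geom_mean_le_arith_mean2_weighted hs1.le hs0.le (by positivity) (by positivity)
        (by ring)
    have hz'pos : 0 < z' t := by positivity
    rw [abs_of_pos hz'pos]
    calc (1 : ℝ) = ((f (u t))⁻¹ ^ (1 - s) * (ρ (v t))⁻¹ ^ s)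
          * (f (u t) ^ (1 - s) * ρ (v t) ^ s) := by
          rw [Real.inv_rpow hfu.le, Real.inv_rpow hρv.le]
          have := (Real.rpow_pos_of_pos hfu (1 - s)).ne'
          have := (Real.rpow_pos_of_pos hρv s).ne'
          field_simp
      _ ≤ z' t * h (z t) := by
          gcongr
          exact hh _ _
  calc (1 : ENNReal) = ∫⁻ _ in Set.Ioo (0 : ℝ) 1, 1 := by simp
    _ ≤ ∫⁻ t in Set.Ioo (0 : ℝ) 1, ENNReal.ofReal |z' t| * ENNReal.ofReal (h (z t)) := by
        refine lintegral_mono fun t => ?_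
        rw [← ENNReal.ofReal_mul (abs_nonneg _)]
        exact ENNReal.one_le_ofReal.2 (hone t)
    _ = ∫⁻ x in z '' Set.Ioo 0 1, ENNReal.ofReal (h x) :=
        (lintegral_image_eq_lintegral_abs_deriv_mul measurableSet_Ioo hz' hz.injOn
          fun x => ENNReal.ofReal (h x)).symm
    _ ≤ ∫⁻ x, ENNReal.ofReal (h x) := setLIntegral_le_lintegral _ _

/-- A Lipschitz function has exponential moments as soon as the norm has all of them. -/
theorem LipschitzWith.integrable_exp {E : Type*} [NormedAddCommGroup E] [MeasurableSpace E]
    [OpensMeasurableSpace E] {ν : Measure E}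
    (hν : ∀ a : ℝ, Integrable (fun x => exp (a * ‖x‖)) ν) {L : NNReal} {f : E → ℝ}
    (hf : LipschitzWith L f) : Integrable (fun x => exp (f x)) ν := by
  refine ((hν L).const_mul (exp (f 0))).mono'
    (hf.continuous.rexp.aestronglyMeasurable) (ae_of_all _ fun x => ?_)
  have h := hf.dist_le_mul x 0
  rw [Real.dist_eq, dist_zero_right] at h
  rw [Real.norm_eq_abs, abs_exp, ← exp_add]
  exact exp_le_exp.2 (by linarith [le_abs_self (f x - f 0)])

theorem LipschitzWith.integrable_exp_mul {E : Type*} [NormedAddCommGroup E] [MeasurableSpace E]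
    [OpensMeasurableSpace E] {ν : Measure E}
    (hν : ∀ a : ℝ, Integrable (fun x => exp (a * ‖x‖)) ν) {L : NNReal} {f : E → ℝ}
    (hf : LipschitzWith L f) (t : ℝ) : Integrable (fun x => exp (t * f x)) ν :=
  ((lipschitzWith_smul t).comp hf).integrable_exp hν

theorem LipschitzWith.zero_mem_interior_integrableExpSet {E : Type*} [NormedAddCommGroup E]
    [MeasurableSpace E] [OpensMeasurableSpace E] {ν : Measure E}
    (hν : ∀ a : ℝ, Integrable (fun x => exp (a * ‖x‖)) ν) {L : NNReal} {f : E → ℝ}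
    (hf : LipschitzWith L f) : 0 ∈ interior (integrableExpSet f ν) := by
  rw [show integrableExpSet f ν = Set.univ from
    Set.eq_univ_of_forall (hf.integrable_exp_mul hν)]
  simp

theorem integrable_exp_mul_norm_gaussianReal (a : ℝ) :
    Integrable (fun x : ℝ => exp (a * ‖x‖)) (gaussianReal 0 1) :=
  integrable_exp_mul_abs (integrable_exp_mul_gaussianReal a) (integrable_exp_mul_gaussianReal (-a))

theorem integrable_exp_mul_norm_pi_gaussianReal {n : ℕ} (a : ℝ) :
    Integrable (fun x : Fin n → ℝ => exp (a * ‖x‖)) (Measure.pi fun _ => gaussianReal 0 1) := by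
  refine (Integrable.fintype_prod (μ := fun _ : Fin n => gaussianReal 0 1)
    (f := fun _ x => exp (|a| * ‖x‖))
    fun _ => integrable_exp_mul_norm_gaussianReal |a|).mono'
    (by fun_prop) (ae_of_all _ fun x => ?_)
  rw [Real.norm_eq_abs, abs_exp, ← exp_sum, ← mul_sum]
  refine exp_le_exp.2 (mul_le_mul (le_abs_self a) ?_ (norm_nonneg _) (abs_nonneg _))
  exact (pi_norm_le_iff_of_nonneg (by positivity)).2 fun i =>
    single_le_sum (f := fun i => ‖x i‖) (fun j _ => norm_nonneg _) (mem_univ i)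

open Filter Topology in
/-- The dual form of Talagrand's transport inequality for the standard Gaussian on the line. -/
theorem integral_exp_le_exp_integral_gaussianReal {L M : NNReal} {g q : ℝ → ℝ}
    (hg : LipschitzWith L g) (hq : LipschitzWith M q)
    (hgq : ∀ y z, g y - (z - y) ^ 2 / 2 ≤ q z) :
    ∫ x, exp (g x) ∂gaussianReal 0 1 ≤ exp (∫ x, q x ∂gaussianReal 0 1) := by
  set φ : ℝ → ℝ := gaussianPDFReal 0 1
  obtain ⟨a, ha⟩ : ∃ a, ∀ x, φ x = exp (a - x ^ 2 / 2) := by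
    refine ⟨log (√(2 * π))⁻¹, fun x => ?_⟩
    rw [sub_eq_add_neg, exp_add, exp_log (by positivity)]
    simp [φ, gaussianPDFReal, neg_div]
  have hφ : Continuous φ := by
    rw [funext ha]
    fun_prop
  have hexp := hg.integrable_exp integrable_exp_mul_norm_gaussianReal
  obtain ⟨ζ, hζ⟩ : ∃ ζ, ∫ x, exp (g x) ∂gaussianReal 0 1 = exp ζ :=
    ⟨_, (exp_log (integral_exp_pos hexp)).symm⟩
  have hρi : Integrable (fun x => φ x * exp (g x)) := by
    rw [gaussianReal_of_var_ne_zero _ one_ne_zero, integrable_withDensity_iff_integrable_smul'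
      (measurable_gaussianPDF _ _) (ae_of_all _ fun x => gaussianPDF_lt_top)] at hexp
    simpa [toReal_gaussianPDF] using hexp
  have hρ : ∫ x, φ x * exp (g x) = exp ζ := by
    rw [← hζ, integral_gaussianReal_eq_integral_smul one_ne_zero]
    rfl
  have key : ∀ s ∈ Set.Ioo (0 : ℝ) 1, s * ζ ≤ cgf q (gaussianReal 0 1) s := fun s hs => by
    have h := one_le_lintegral_of_prekopaLeindler (f := φ)
      (ρ := fun x => exp (-ζ) * (φ x * exp (g x)))
      (h := fun x => exp (-(s * ζ)) * (φ x * exp (s * q x))) hs hφ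
      (fun x => gaussianPDFReal_pos _ _ _ one_ne_zero) (integrable_gaussianPDFReal _ _)
      (integral_gaussianPDFReal_eq_one _ one_ne_zero)
      (by have := hg.continuous; fun_prop)
      (fun x => by simp only [ha]; positivity) (hρi.const_mul _)
      (by rw [integral_const_mul, hρ, ← exp_add]; simp)
      (fun x y => by
        simp only [ha, ← exp_add, ← exp_mul]
        refine exp_le_exp.2 ?_
        have h1 := mul_le_mul_of_nonneg_left (hgq y ((1 - s) * x + s * y)) hs.1.le
        have h2 : 0 ≤ s ^ 2 * (1 - s) * (x - y) ^ 2 :=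
          mul_nonneg (mul_nonneg (sq_nonneg _) (sub_nonneg.2 hs.2.le)) (sq_nonneg _)
        nlinarith)
    have hqe := hq.integrable_exp_mul integrable_exp_mul_norm_gaussianReal s
    have hmgf : ∫ x, φ x * exp (s * q x) = mgf q (gaussianReal 0 1) s := by
      rw [mgf, integral_gaussianReal_eq_integral_smul one_ne_zero]
      rfl
    have hqi : Integrable (fun x => φ x * exp (s * q x)) := by
      rw [gaussianReal_of_var_ne_zero _ one_ne_zero, integrable_withDensity_iff_integrable_smul'
        (measurable_gaussianPDF _ _) (ae_of_all _ fun x => gaussianPDF_lt_top)] at hqe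
      simpa [toReal_gaussianPDF] using hqe
    rw [← ofReal_integral_eq_lintegral_ofReal (hqi.const_mul _)
      (ae_of_all _ fun x => by simp only [ha]; positivity), ENNReal.one_le_ofReal,
      integral_const_mul, hmgf, exp_neg, ← div_eq_inv_mul, one_le_div (exp_pos _)] at h
    exact (le_log_iff_exp_le (mgf_pos hqe)).2 h
  rw [hζ, exp_le_exp]
  have hint := hq.zero_mem_interior_integrableExpSet integrable_exp_mul_norm_gaussianReal
  have hderiv : HasDerivAt (cgf q (gaussianReal 0 1)) (∫ x, q x ∂gaussianReal 0 1) 0 := by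
    have := (analyticAt_cgf hint).differentiableAt.hasDerivAt
    rwa [deriv_cgf_zero hint, probReal_univ, div_one] at this
  refine ge_of_tendsto (hderiv.tendsto_slope_zero_right) ?_
  filter_upwards [Ioo_mem_nhdsGT (zero_lt_one' ℝ)] with s hs
  rw [zero_add, cgf_zero, sub_zero, smul_eq_mul, ← div_eq_inv_mul, le_div_iff₀ hs.1, mul_comm]
  exact key s hs

theorem isometry_cons_left {n : ℕ} (y : Fin n → ℝ) :
    Isometry fun x : ℝ => (Fin.cons x y : Fin (n + 1) → ℝ) :=
  Isometry.of_dist_eq fun a b => le_antisymm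
    ((dist_pi_le_iff dist_nonneg).2 <| Fin.forall_fin_succ.2 ⟨by simp, fun i => by simp⟩)
    (by simpa using dist_le_pi_dist (Fin.cons a y : Fin (n + 1) → ℝ) (Fin.cons b y) 0)

theorem isometry_cons_right {n : ℕ} (x : ℝ) :
    Isometry fun y : Fin n → ℝ => (Fin.cons x y : Fin (n + 1) → ℝ) :=
  Isometry.of_dist_eq fun a b => le_antisymm
    ((dist_pi_le_iff dist_nonneg).2 <| Fin.forall_fin_succ.2
      ⟨by simp, fun i => by simpa using dist_le_pi_dist a b i⟩)
    ((dist_pi_le_iff dist_nonneg).2 fun i => by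
      simpa using dist_le_pi_dist (Fin.cons x a : Fin (n + 1) → ℝ) (Fin.cons x b) i.succ)

theorem integral_pi_fin_succ {n : ℕ} {ν : Measure ℝ} [SigmaFinite ν] {f : (Fin (n + 1) → ℝ) → ℝ}
    (hf : Integrable f (Measure.pi fun _ => ν)) :
    ∫ x, f x ∂(Measure.pi fun _ => ν) =
      ∫ y, ∫ x, f (Fin.cons x y) ∂ν ∂(Measure.pi fun _ : Fin n => ν) := by
  have hmp := (measurePreserving_piFinSuccAbove (fun _ : Fin (n + 1) => ν) 0).symm
  rw [← hmp.integral_comp', integral_prod_symm]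
  · simp only [MeasurableEquiv.piFinSuccAbove, MeasurableEquiv.symm_mk, MeasurableEquiv.coe_mk,
      Fin.insertNthEquiv_zero, Equiv.symm_symm]
    rfl
  · exact (hmp.integrable_comp_emb (MeasurableEquiv.measurableEmbedding _)).2 hf

/-- The dual form of Talagrand's transport inequality for the standard Gaussian on `ℝⁿ`. -/
theorem integral_exp_le_exp_integral_pi_gaussianReal {n : ℕ} {L M : NNReal}
    {g q : (Fin n → ℝ) → ℝ} (hg : LipschitzWith L g) (hq : LipschitzWith M q)
    (hgq : ∀ y z, g y - (∑ i, (z i - y i) ^ 2) / 2 ≤ q z) :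
    ∫ x, exp (g x) ∂(Measure.pi fun _ => gaussianReal 0 1)
      ≤ exp (∫ x, q x ∂(Measure.pi fun _ => gaussianReal 0 1)) := by
  induction n generalizing L M with
  | zero => simpa [Measure.pi_of_empty _ default] using hgq default default
  | succ n ih =>
    have hg₁ : ∀ y : Fin n → ℝ, LipschitzWith L fun x : ℝ => g (Fin.cons x y) := fun y => by
      simpa using! hg.comp (isometry_cons_left y).lipschitz
    have hq₁ : ∀ y : Fin n → ℝ, LipschitzWith M fun x : ℝ => q (Fin.cons x y) := fun y => by
      simpa using! hq.comp (isometry_cons_left y).lipschitz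
    have hi := fun y => (hg₁ y).integrable_exp integrable_exp_mul_norm_gaussianReal
    have hqi := fun y => integrable_of_mem_interior_integrableExpSet
      ((hq₁ y).zero_mem_interior_integrableExpSet integrable_exp_mul_norm_gaussianReal)
    have hpos := fun y => integral_exp_pos (hi y)
    set G : (Fin n → ℝ) → ℝ := fun y => log (∫ x, exp (g (Fin.cons x y)) ∂gaussianReal 0 1)
    set Q : (Fin n → ℝ) → ℝ := fun y => ∫ x, q (Fin.cons x y) ∂gaussianReal 0 1
    have hG : LipschitzWith L G := LipschitzWith.of_le_add_mul L fun y y' => by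
      refine (log_le_iff_le_exp (hpos y)).2 ?_
      rw [exp_add, exp_log (hpos y'), ← integral_mul_const]
      refine integral_mono (hi y) ((hi y').mul_const _) fun x => ?_
      have h := hg.le_add_mul (Fin.cons x y) (Fin.cons x y')
      rw [(isometry_cons_right x).dist_eq] at h
      simpa only [← exp_add] using exp_le_exp.2 h
    have hQ : LipschitzWith M Q := LipschitzWith.of_le_add_mul M fun y y' => by
      have h : Q y ≤ ∫ x, (q (Fin.cons x y') + M * dist y y') ∂gaussianReal 0 1 := by
        refine integral_mono (hqi y) ((hqi y').add (integrable_const _)) fun x => ?_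
        have h := hq.le_add_mul (Fin.cons x y) (Fin.cons x y')
        rwa [(isometry_cons_right x).dist_eq] at h
      rw [integral_add (hqi y') (integrable_const _)] at h
      simpa using h
    have hGQ : ∀ y z, G y - (∑ i, (z i - y i) ^ 2) / 2 ≤ Q z := fun y z => by
      set c := (∑ i, (z i - y i) ^ 2) / 2 with hc
      have h := integral_exp_le_exp_integral_gaussianReal (hg₁ y)
        (q := fun x => q (Fin.cons x z) + c) (M := M)
        (by simpa using (hq₁ z).add (LipschitzWith.const c)) fun a b => by
          have := hgq (Fin.cons a y) (Fin.cons b z)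
          simp only [Fin.sum_univ_succ, Fin.cons_zero, Fin.cons_succ] at this
          linarith
      rw [integral_add (hqi z) (integrable_const _)] at h
      have := (log_le_iff_le_exp (hpos y)).2 h
      simp only [integral_const, probReal_univ, one_smul] at this
      linarith
    rw [integral_pi_fin_succ (hg.integrable_exp integrable_exp_mul_norm_pi_gaussianReal),
      integral_pi_fin_succ (integrable_of_mem_interior_integrableExpSet
        (hq.zero_mem_interior_integrableExpSet integrable_exp_mul_norm_pi_gaussianReal))]
    calc _ = ∫ y, exp (G y) ∂(Measure.pi fun _ => gaussianReal 0 1) := by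
          simp only [G, exp_log (hpos _)]
      _ ≤ _ := ih hG hQ hGQ

/-- The **Tsirelson–Ibragimov–Sudakov inequality**: a function that is `√c`-Lipschitz for the
Euclidean norm is sub-Gaussian with variance proxy `c` under the standard Gaussian measure. -/
theorem hasSubgaussianMGF_sub_integral_pi_gaussianReal {n : ℕ} {L c : NNReal}
    {f : (Fin n → ℝ) → ℝ} (hf : LipschitzWith L f)
    (hc : ∀ x y, |f x - f y| ≤ √(c * ∑ i, (x i - y i) ^ 2)) :
    HasSubgaussianMGF (fun x => f x - ∫ y, f y ∂(Measure.pi fun _ => gaussianReal 0 1)) c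
      (Measure.pi fun _ => gaussianReal 0 1) := by
  have hν := integrable_exp_mul_norm_pi_gaussianReal (n := n)
  set γ : Measure (Fin n → ℝ) := Measure.pi fun _ => gaussianReal 0 1
  set m := ∫ y, f y ∂γ
  have hi := integrable_of_mem_interior_integrableExpSet
    (hf.zero_mem_interior_integrableExpSet hν)
  have hsub : ∀ t : ℝ, (fun x => exp (t * (f x - m))) = fun x => exp (t * f x) * exp (-(t * m)) :=
    fun t => funext fun x => by rw [← exp_add]; ring_nf
  refine ⟨fun t => ?_, fun t => ?_⟩
  · rw [hsub]
    exact (hf.integrable_exp_mul hν t).mul_const _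
  · have hg : LipschitzWith (‖t‖₊ * L) fun x => t * f x := (lipschitzWith_smul t).comp hf
    have h := integral_exp_le_exp_integral_pi_gaussianReal hg
      (q := fun x => t * f x + c * t ^ 2 / 2) (M := ‖t‖₊ * L)
      (by simpa using hg.add (LipschitzWith.const (c * t ^ 2 / 2))) fun y z => by
        set S := ∑ i, (z i - y i) ^ 2
        have hS : 0 ≤ S := sum_nonneg fun i _ => sq_nonneg _
        have h1 := abs_le_of_sq_le_sq' (a := t * (f y - f z)) (b := (c * t ^ 2 + S) / 2)
          (by
            have h2 := (sq_le_sq₀ (abs_nonneg _) (sqrt_nonneg _)).2 (hc z y)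
            rw [sq_abs, sq_sqrt (by positivity)] at h2
            nlinarith [sq_nonneg (c * t ^ 2 - S), mul_le_mul_of_nonneg_left h2 (sq_nonneg t)])
          (by positivity)
        linarith [h1.2]
    rw [integral_add (hi.const_mul t) (integrable_const _), integral_const_mul] at h
    simp only [integral_const, probReal_univ, one_smul] at h
    rw [mgf, hsub, integral_mul_const]
    calc _ ≤ exp (t * m + c * t ^ 2 / 2) * exp (-(t * m)) := by gcongr
      _ = exp (c * t ^ 2 / 2) := by rw [← exp_add]; ring_nf

theorem hasSubgaussianMGF_gaussianReal_const_sub (m : ℝ) :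
    HasSubgaussianMGF (fun x => m - x) 1 (gaussianReal m 1) := by
  have hmap : (gaussianReal m 1).map (fun x => m - x) = gaussianReal 0 1 := by
    simpa using gaussianReal_map_const_sub (μ := m) (v := 1) m
  refine (HasSubgaussianMGF.id_map_iff (by fun_prop)).1 ?_
  rw [hmap]
  exact ⟨integrable_exp_mul_gaussianReal, fun t => by simp [mgf_id_gaussianReal]⟩

theorem abs_sup'_sub_sup'_le {ι : Type*} {s : Finset ι} (hs : s.Nonempty) {a b : ι → ℝ} {r : ℝ}
    (h : ∀ i ∈ s, |a i - b i| ≤ r) : |s.sup' hs a - s.sup' hs b| ≤ r := by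
  rw [abs_sub_le_iff, sub_le_iff_le_add, sub_le_iff_le_add]
  constructor <;> refine sup'_le hs _ fun i hi => ?_
  · linarith [(abs_sub_le_iff.1 (h i hi)).1, le_sup' b hi]
  · linarith [(abs_sub_le_iff.1 (h i hi)).2, le_sup' a hi]

/-- The scan statistic `max_{S ∈ C} x_S` over sets of size `K` is sub-Gaussian with variance
proxy `K`. -/
theorem hasSubgaussianMGF_sup'_sum {n K : ℕ} {C : Finset (Finset (Fin n))} (hC : C.Nonempty)
    (hcard : ∀ S ∈ C, S.card = K) :
    HasSubgaussianMGF (fun x => C.sup' hC (fun S => ∑ i ∈ S, x i)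
        - ∫ y, C.sup' hC (fun S => ∑ i ∈ S, y i) ∂(Measure.pi fun _ => gaussianReal 0 1)) K
      (Measure.pi fun _ : Fin n => gaussianReal 0 1) := by
  refine hasSubgaussianMGF_sub_integral_pi_gaussianReal (L := K) ?_ fun x y => ?_
  · refine LipschitzWith.of_dist_le_mul fun x y => abs_sup'_sub_sup'_le hC fun S hS => ?_
    rw [← sum_sub_distrib]
    calc _ ≤ ∑ i ∈ S, |x i - y i| := abs_sum_le_sum_abs _ _
      _ ≤ ∑ i ∈ S, dist x y := sum_le_sum fun i _ => dist_le_pi_dist x y i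
      _ = _ := by simp [hcard S hS]
  · refine abs_sup'_sub_sup'_le hC fun S hS => ?_
    rw [← sum_sub_distrib]
    refine abs_le_sqrt (sq_sum_le_card_mul_sum_sq.trans ?_)
    rw [hcard S hS, NNReal.coe_natCast]
    gcongr
    exact subset_univ S

/-- The lower tail of `x_S` when the coordinates in `S` are Gaussian with mean `μ`. -/
theorem measureReal_sum_le_exp {n : ℕ} (S : Finset (Fin n)) (μ : ℝ) {t : ℝ} (ht : 0 ≤ t) :
    (Measure.pi fun i => gaussianReal (if i ∈ S then μ else 0) 1).real
      {x | ∑ i ∈ S, x i ≤ μ * S.card - t} ≤ exp (-t ^ 2 / (2 * S.card)) := by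
  set m : Fin n → ℝ := fun i => if i ∈ S then μ else 0
  have hind : iIndepFun (fun i (x : Fin n → ℝ) => m i - x i)
      (Measure.pi fun i => gaussianReal (m i) 1) :=
    iIndepFun_pi (X := fun i x => m i - x) fun i => by fun_prop
  have h := HasSubgaussianMGF.measure_sum_ge_le_of_iIndepFun hind (c := fun _ => 1) (s := S)
    (fun i _ => .of_map (X := fun x => m i - x) (Y := fun x : Fin n → ℝ => x i)
      (measurable_pi_apply i).aemeasurable (by
      rw [(measurePreserving_eval (fun i => gaussianReal (m i) 1) i).map_eq]
      exact hasSubgaussianMGF_gaussianReal_const_sub _)) ht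
  have hm : ∑ i ∈ S, m i = μ * S.card := by
    rw [sum_congr rfl fun i hi => if_pos hi, sum_const, nsmul_eq_mul, mul_comm]
  simp only [sum_sub_distrib, hm, sum_const, nsmul_eq_mul, mul_one, NNReal.coe_natCast] at h
  simpa only [le_sub_comm] using h

/-- The maximum test `f(x) = 1{max_{S∈C} x_S ≥ (μK + E₀max X_S)/2}`
satisfies `R(f) ≤ δ` whenever `μ ≥ (E₀ max_{S∈C} X_S)/K + 2√((2/K)·log(2/δ))`. -/
theorem stmt7 (n K : ℕ) (hn : 0 < n) (hK : 0 < K) (μ δ : ℝ) (hμ : 0 < μ)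
    (hδ : δ ∈ Set.Ioo (0:ℝ) 1)
    (C : Finset (Finset (Fin n))) (hC : C.Nonempty) (hcard : ∀ S ∈ C, S.card = K)
    (P₀ : Measure (Fin n → ℝ))
    (hP₀ : P₀ = Measure.pi fun _ : Fin n => gaussianReal 0 1)
    (Ps : Finset (Fin n) → Measure (Fin n → ℝ))
    (hPs : ∀ S, Ps S = Measure.pi fun i : Fin n =>
      gaussianReal (if i ∈ S then μ else 0) 1)
    (Emax : ℝ)
    (hEmax : Emax = ∫ x, C.sup' hC (fun S => ∑ i ∈ S, x i) ∂P₀)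
    (R : ℝ)
    (hR : R = (P₀ {x | C.sup' hC (fun S => ∑ i ∈ S, x i) ≥ (μ * K + Emax) / 2}).toReal
      + (1 / (C.card : ℝ)) * ∑ S ∈ C,
          ((Ps S) {x | ¬ (C.sup' hC (fun T => ∑ i ∈ T, x i) ≥ (μ * K + Emax) / 2)}).toReal)
    (hμbig : μ ≥ Emax / K + 2 * Real.sqrt ((2 / (K : ℝ)) * Real.log (2 / δ))) :
    R ≤ δ := by
  subst hP₀ hEmax
  set E := ∫ x, C.sup' hC (fun S => ∑ i ∈ S, x i) ∂(Measure.pi fun _ : Fin n => gaussianReal 0 1)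
  have hK' : (0 : ℝ) < K := Nat.cast_pos.2 hK
  set ℓ := log (2 / δ)
  have hℓ : 0 ≤ ℓ := log_nonneg ((one_le_div hδ.1).2 (by linarith [hδ.2]))
  set t := (μ * K - E) / 2 with htdef
  have hr : √(2 / K * ℓ) * K ≤ t := by
    have h := mul_le_mul_of_nonneg_right hμbig hK'.le
    rw [add_mul, div_mul_cancel₀ _ hK'.ne'] at h
    linarith
  have ht : 0 ≤ t := le_trans (by positivity) hr
  have hexp : exp (-t ^ 2 / (2 * K)) ≤ δ / 2 := by
    have hsq : 2 * K * ℓ ≤ t ^ 2 := by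
      have h := pow_le_pow_left₀ (by positivity) hr 2
      rw [mul_pow, sq_sqrt (by positivity)] at h
      calc 2 * K * ℓ = 2 / K * ℓ * K ^ 2 := by field_simp
        _ ≤ t ^ 2 := h
    calc exp (-t ^ 2 / (2 * K)) ≤ exp (-ℓ) := by
          rw [exp_le_exp, div_le_iff₀ (by positivity)]
          linarith
      _ = δ / 2 := by rw [exp_neg, exp_log (div_pos two_pos hδ.1), inv_div]
  have htype₁ := (hasSubgaussianMGF_sup'_sum hC hcard).measure_ge_le ht
  have hset : {x : Fin n → ℝ | C.sup' hC (fun S => ∑ i ∈ S, x i) ≥ (μ * K + E) / 2}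
      = {x | t ≤ C.sup' hC (fun S => ∑ i ∈ S, x i) - E} := by
    ext x
    simp only [Set.mem_ofPred_eq, ge_iff_le, htdef, le_sub_iff_add_le]
    ring_nf
  have htype₂ : ∀ S ∈ C, ((Ps S) {x | ¬ (C.sup' hC (fun T => ∑ i ∈ T, x i)
      ≥ (μ * K + E) / 2)}).toReal ≤ δ / 2 := fun S hS => by
    rw [hPs S]
    refine le_trans (measureReal_mono fun x hx => ?_)
      ((measureReal_sum_le_exp S μ ht).trans (by rwa [hcard S hS]))
    have hx' := not_le.1 hx
    have := le_sup' (fun T => ∑ i ∈ T, x i) hS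
    simp only [Set.mem_ofPred_eq, hcard S hS]
    linarith
  have hC' : (0 : ℝ) < C.card := Nat.cast_pos.2 hC.card_pos
  rw [hR, hset]
  calc _ ≤ δ / 2 + 1 / (C.card : ℝ) * ∑ S ∈ C, δ / 2 :=
        add_le_add (htype₁.trans (by simpa using hexp))
          (mul_le_mul_of_nonneg_left (sum_le_sum htype₂) (by positivity))
    _ = δ := by
        rw [sum_const, nsmul_eq_mul]
        field_simp
        ring
end

section
/- For every ε ∈ (0,1) there exist n, μ > 0, and classes A ⊆ C of subsets of {1,...,n} such that the Bayes risks satisfy R*_A(μ) ≥ 1 - ε and R*_C(μ) ≤ 2ε. In particular, the Bayes risk R*_C(μ) is not monotone with respect to inclusion of classes. -/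
open MeasureTheory Real Finset

section Densities

variable {f h : ℝ → ℝ}

/-- The total variation distance between a product density and the uniform mixture of its
one-coordinate perturbations is controlled by the `χ²` divergence of a single coordinate. -/
theorem integral_abs_prod_sub_average_le {n : ℕ} (hn : 0 < n) (hf0 : ∀ x, 0 < f x)
    (hf : Integrable f) (hh : Integrable h) (hf1 : ∫ x, f x = 1) (hh1 : ∫ x, h x = 1)
    (hw : Integrable fun x ↦ h x ^ 2 / f x) {δ : ℝ} (hδ : 0 < δ) :
    ∫ x : Fin n → ℝ, |∏ k, f (x k) - 1 / (n : ℝ) * ∑ i, ∏ k, if k = i then h (x k) else f (x k)|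
      ≤ δ / 2 + (∫ t, (f t - h t) ^ 2 / f t) / (2 * n * δ) := by
  have hn' : (0 : ℝ) < n := by exact_mod_cast hn
  have hsq : (fun t ↦ (f t - h t) ^ 2 / f t) = fun t ↦ f t - 2 * h t + h t ^ 2 / f t := by
    funext t
    have := (hf0 t).ne'
    field_simp
    ring
  have hw' : Integrable fun t ↦ (f t - h t) ^ 2 / f t := by
    rw [hsq]
    exact (hf.sub (hh.const_mul 2)).add hw
  let u : Fin n → Fin n → Fin n → ℝ → ℝ := fun i j k t ↦
    (if k = i then f t - h t else f t) * (if k = j then f t - h t else f t) / f t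
  have hu : ∀ i j k, Integrable (u i j k) := by
    intro i j k
    by_cases hi : k = i <;> by_cases hj : k = j
    · refine hw'.congr (Filter.Eventually.of_forall fun t ↦ ?_)
      simp only [u, if_pos hi, if_pos hj]
      ring
    · refine (hf.sub hh).congr (Filter.Eventually.of_forall fun t ↦ ?_)
      have := (hf0 t).ne'
      simp only [u, if_pos hi, if_neg hj, Pi.sub_apply]
      field_simp
    · refine (hf.sub hh).congr (Filter.Eventually.of_forall fun t ↦ ?_)
      have := (hf0 t).ne'
      simp only [u, if_neg hi, if_pos hj, Pi.sub_apply]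
      field_simp
    · refine hf.congr (Filter.Eventually.of_forall fun t ↦ ?_)
      have := (hf0 t).ne'
      simp only [u, if_neg hi, if_neg hj]
      field_simp
  have hint : ∀ i j, Integrable fun x : Fin n → ℝ ↦ ∏ k, u i j k (x k) :=
    fun i j ↦ Integrable.fintype_prod (hu i j)
  have hval : ∀ i j, ∫ x : Fin n → ℝ, ∏ k, u i j k (x k) =
      if i = j then ∫ t, (f t - h t) ^ 2 / f t else 0 := by
    intro i j
    rw [integral_fintype_prod_volume_eq_prod]
    split_ifs with hij
    · subst hij
      rw [Finset.prod_eq_single i]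
      · congr 1
        funext t
        simp only [u, if_true]
        ring
      · intro k _ hk
        rw [← hf1]
        congr 1
        funext t
        have := (hf0 t).ne'
        simp only [u, if_neg hk]
        field_simp
      · simp
    · refine Finset.prod_eq_zero (Finset.mem_univ i) ?_
      have : u i j i = fun t ↦ f t - h t := by
        funext t
        have := (hf0 t).ne'
        simp only [u, if_true, if_neg hij]
        field_simp
      rw [this, integral_sub hf hh, hf1, hh1, sub_self]
  have hP : Integrable fun x : Fin n → ℝ ↦ ∏ k, f (x k) :=
    Integrable.fintype_prod (f := fun _ ↦ f) fun _ ↦ hf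
  have hP1 : ∫ x : Fin n → ℝ, ∏ k, f (x k) = 1 := by
    rw [integral_fintype_prod_volume_eq_pow, hf1, one_pow]
  have hS : Integrable fun x : Fin n → ℝ ↦ ∑ i, ∑ j, ∏ k, u i j k (x k) :=
    integrable_finsetSum _ fun i _ ↦ integrable_finsetSum _ fun j _ ↦ hint i j
  have hS1 : ∫ x : Fin n → ℝ, ∑ i, ∑ j, ∏ k, u i j k (x k) =
      n * ∫ t, (f t - h t) ^ 2 / f t := by
    rw [integral_finsetSum _ fun i _ ↦ integrable_finsetSum _ fun j _ ↦ hint i j]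
    simp_rw [integral_finsetSum _ fun j _ ↦ hint _ j, hval]
    simp
  have hpt : ∀ x : Fin n → ℝ,
      |∏ k, f (x k) - 1 / (n : ℝ) * ∑ i, ∏ k, if k = i then h (x k) else f (x k)| ≤
        δ / 2 * ∏ k, f (x k) + 1 / (2 * n ^ 2 * δ) * ∑ i, ∑ j, ∏ k, u i j k (x k) := by
    intro x
    set P := ∏ k, f (x k) with hPdef
    have hPpos : 0 < P := Finset.prod_pos fun k _ ↦ hf0 _
    let d : Fin n → ℝ := fun i ↦ ∏ k, if k = i then f (x k) - h (x k) else f (x k)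
    have hd : ∀ i, d i = P - ∏ k, if k = i then h (x k) else f (x k) := by
      intro i
      simp only [d, hPdef]
      rw [← Finset.mul_prod_erase _ _ (Finset.mem_univ i),
        ← Finset.mul_prod_erase _ (fun k ↦ f (x k)) (Finset.mem_univ i),
        ← Finset.mul_prod_erase _ (fun k ↦ if k = i then h (x k) else f (x k))
          (Finset.mem_univ i)]
      have h1 : ∏ k ∈ Finset.univ.erase i, (if k = i then f (x k) - h (x k) else f (x k)) =
          ∏ k ∈ Finset.univ.erase i, f (x k) :=
        Finset.prod_congr rfl fun k hk ↦ if_neg (Finset.ne_of_mem_erase hk)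
      have h2 : ∏ k ∈ Finset.univ.erase i, (if k = i then h (x k) else f (x k)) =
          ∏ k ∈ Finset.univ.erase i, f (x k) :=
        Finset.prod_congr rfl fun k hk ↦ if_neg (Finset.ne_of_mem_erase hk)
      rw [h1, h2, if_pos rfl, if_pos rfl]
      ring
    have hdu : ∑ i, ∑ j, ∏ k, u i j k (x k) = (∑ i, d i) ^ 2 / P := by
      rw [sq, Finset.sum_mul_sum, Finset.sum_div]
      refine Finset.sum_congr rfl fun i _ ↦ ?_
      rw [Finset.sum_div]
      refine Finset.sum_congr rfl fun j _ ↦ ?_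
      simp only [u, d, hPdef]
      rw [Finset.prod_div_distrib, Finset.prod_mul_distrib]
    have hsum : P - 1 / (n : ℝ) * ∑ i, ∏ k, (if k = i then h (x k) else f (x k)) =
        1 / n * ∑ i, d i := by
      simp_rw [hd, Finset.sum_sub_distrib]
      simp only [Finset.sum_const, Finset.card_univ, Fintype.card_fin, nsmul_eq_mul]
      field_simp
    rw [hsum, hdu]
    set D := ∑ i, d i
    have key : δ / 2 * P + 1 / (2 * n ^ 2 * δ) * (D ^ 2 / P) - 1 / n * |D| =
        (δ * P * n - |D|) ^ 2 / (2 * n ^ 2 * δ * P) := by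
      rw [← sq_abs D]
      field_simp
      ring
    have : 0 ≤ (δ * P * n - |D|) ^ 2 / (2 * n ^ 2 * δ * P) := by positivity
    rw [abs_mul, abs_of_pos (show (0 : ℝ) < 1 / n by positivity)]
    linarith
  calc _ ≤ ∫ x : Fin n → ℝ,
          (δ / 2 * ∏ k, f (x k) + 1 / (2 * n ^ 2 * δ) * ∑ i, ∑ j, ∏ k, u i j k (x k)) :=
        integral_mono_of_nonneg (Filter.Eventually.of_forall fun _ ↦ abs_nonneg _)
          ((hP.const_mul _).add (hS.const_mul _)) (Filter.Eventually.of_forall hpt)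
    _ = _ := by
        rw [integral_add (hP.const_mul _) (hS.const_mul _), integral_const_mul,
          integral_const_mul, hP1, hS1]
        field_simp

theorem sqrt_mul_le_half_add {a b : ℝ} (ha : 0 ≤ a) (hb : 0 ≤ b) : √(a * b) ≤ (a + b) / 2 := by
  rw [Real.sqrt_mul ha]
  nlinarith [sq_nonneg (√a - √b), Real.sq_sqrt ha, Real.sq_sqrt hb]

theorem integrable_sqrt_mul (hf0 : ∀ x, 0 ≤ f x) (hh0 : ∀ x, 0 ≤ h x) (hf : Integrable f)
    (hh : Integrable h) : Integrable fun x ↦ √(f x * h x) := by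
  refine ((hf.add hh).div_const 2).mono'
    (Real.continuous_sqrt.comp_aestronglyMeasurable (hf.1.mul hh.1))
    (Filter.Eventually.of_forall fun x ↦ ?_)
  rw [Real.norm_of_nonneg (Real.sqrt_nonneg _)]
  exact sqrt_mul_le_half_add (hf0 x) (hh0 x)

/-- Testing affinity of product densities is at most the corresponding power of the
Bhattacharyya coefficient. -/
theorem one_sub_half_integral_abs_prod_sub_prod_le {n : ℕ} (hf0 : ∀ x, 0 ≤ f x)
    (hh0 : ∀ x, 0 ≤ h x) (hf : Integrable f) (hh : Integrable h) (hf1 : ∫ x, f x = 1)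
    (hh1 : ∫ x, h x = 1) :
    1 - 1 / 2 * ∫ x : Fin n → ℝ, |∏ k, f (x k) - ∏ k, h (x k)| ≤
      (∫ t, √(f t * h t)) ^ n := by
  have hP : Integrable fun x : Fin n → ℝ ↦ ∏ k, f (x k) :=
    Integrable.fintype_prod (f := fun _ ↦ f) fun _ ↦ hf
  have hQ : Integrable fun x : Fin n → ℝ ↦ ∏ k, h (x k) :=
    Integrable.fintype_prod (f := fun _ ↦ h) fun _ ↦ hh
  have hR : Integrable fun x : Fin n → ℝ ↦ ∏ k, √(f (x k) * h (x k)) :=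
    Integrable.fintype_prod (f := fun _ t ↦ √(f t * h t))
      fun _ ↦ integrable_sqrt_mul hf0 hh0 hf hh
  have hP1 : ∫ x : Fin n → ℝ, ∏ k, f (x k) = 1 := by
    rw [integral_fintype_prod_volume_eq_pow, hf1, one_pow]
  have hQ1 : ∫ x : Fin n → ℝ, ∏ k, h (x k) = 1 := by
    rw [integral_fintype_prod_volume_eq_pow, hh1, one_pow]
  have hR1 : ∫ x : Fin n → ℝ, ∏ k, √(f (x k) * h (x k)) = (∫ t, √(f t * h t)) ^ n := by
    rw [integral_fintype_prod_volume_eq_pow (fun t ↦ √(f t * h t)), Fintype.card_fin]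
  have hle : ∫ x : Fin n → ℝ,
      (∏ k, f (x k) + ∏ k, h (x k) - 2 * ∏ k, √(f (x k) * h (x k))) ≤
      ∫ x : Fin n → ℝ, |∏ k, f (x k) - ∏ k, h (x k)| := by
    refine integral_mono ((hP.add hQ).sub (hR.const_mul 2)) (hP.sub hQ).abs fun x ↦ ?_
    have hp : 0 ≤ ∏ k, f (x k) := Finset.prod_nonneg fun k _ ↦ hf0 _
    have hq : 0 ≤ ∏ k, h (x k) := Finset.prod_nonneg fun k _ ↦ hh0 _
    have hr : ∏ k, √(f (x k) * h (x k)) = √(∏ k, f (x k)) * √(∏ k, h (x k)) := by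
      rw [← Real.sqrt_mul hp, ← Finset.prod_mul_distrib, Real.sqrt_prod]
      exact fun k _ ↦ mul_nonneg (hf0 _) (hh0 _)
    simp only [hr]
    generalize ∏ k, f (x k) = p at hp
    generalize ∏ k, h (x k) = q at hq
    have h1 := Real.sq_sqrt hp
    have h2 := Real.sq_sqrt hq
    rcases le_total p q with hpq | hpq
    · rw [abs_of_nonpos (by linarith)]
      nlinarith [Real.sqrt_nonneg p, Real.sqrt_le_sqrt hpq]
    · rw [abs_of_nonneg (by linarith)]
      nlinarith [Real.sqrt_nonneg q, Real.sqrt_le_sqrt hpq]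
  rw [integral_sub (by exact hP.add hQ) (hR.const_mul 2), integral_add hP hQ, integral_const_mul, hP1,
    hQ1, hR1] at hle
  linarith

theorem integral_sqrt_mul_lt_one (hf0 : ∀ x, 0 ≤ f x) (hh0 : ∀ x, 0 ≤ h x)
    (hfc : Continuous f) (hhc : Continuous h) (hf : Integrable f) (hh : Integrable h)
    (hf1 : ∫ x, f x = 1) (hh1 : ∫ x, h x = 1) {a : ℝ} (ha : f a ≠ h a) :
    ∫ t, √(f t * h t) < 1 := by
  have hi := integrable_sqrt_mul hf0 hh0 hf hh
  have hpos : 0 < ∫ t, ((f t + h t) / 2 - √(f t * h t)) := by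
    refine integral_pos_of_integrable_nonneg_nonzero (x := a) (by fun_prop)
      (((hf.add hh).div_const 2).sub hi)
      (fun t ↦ sub_nonneg.2 (sqrt_mul_le_half_add (hf0 t) (hh0 t))) ?_
    intro h0
    have hs := Real.sq_sqrt (mul_nonneg (hf0 a) (hh0 a))
    rw [← sub_eq_zero.1 h0] at hs
    exact ha (sub_eq_zero.1 (pow_eq_zero_iff two_ne_zero |>.1 (by linarith :
      (f a - h a) ^ 2 = 0)))
  rw [integral_sub (by exact (hf.add hh).div_const 2) hi, integral_div, integral_add hf hh, hf1,
    hh1] at hpos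
  linarith

end Densities

open ProbabilityTheory

theorem prod_gaussianPDFReal_shift {n : ℕ} (x m : Fin n → ℝ) :
    (2 * π) ^ (-(n : ℝ) / 2) * Real.exp (-(∑ i, (x i - m i) ^ 2) / 2) =
      ∏ i, gaussianPDFReal (m i) 1 (x i) := by
  simp only [gaussianPDFReal, NNReal.coe_one, mul_one]
  rw [Finset.prod_mul_distrib, ← Real.exp_sum, ← Finset.sum_div, Finset.sum_neg_distrib]
  congr 1
  rw [Finset.prod_const, Finset.card_univ, Fintype.card_fin, Real.sqrt_eq_rpow,
    ← Real.rpow_neg (by positivity), ← Real.rpow_natCast, ← Real.rpow_mul (by positivity)]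
  congr 1
  ring

theorem gaussianPDFReal_sq_div (x : ℝ) :
    gaussianPDFReal 1 1 x ^ 2 / gaussianPDFReal 0 1 x = Real.exp 1 * gaussianPDFReal 2 1 x := by
  rw [div_eq_iff (gaussianPDFReal_pos 0 1 x one_ne_zero).ne']
  simp only [gaussianPDFReal, NNReal.coe_one, mul_one]
  rw [mul_pow, ← Real.exp_nat_mul]
  have : Real.exp ((2 : ℕ) * (-(x - 1) ^ 2 / 2)) =
      Real.exp 1 * Real.exp (-(x - 2) ^ 2 / 2) * Real.exp (-(x - 0) ^ 2 / 2) := by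
    rw [← Real.exp_add, ← Real.exp_add]
    congr 1
    push_cast
    ring
  rw [this]
  ring

theorem continuous_gaussianPDFReal (m : ℝ) : Continuous (gaussianPDFReal m 1) := by
  rw [gaussianPDFReal_def]
  fun_prop

theorem gaussianPDFReal_zero_ne_one : gaussianPDFReal 0 1 0 ≠ gaussianPDFReal 1 1 0 := by
  simp only [gaussianPDFReal]
  intro h
  have := Real.exp_injective (mul_left_cancel₀ (by positivity) h)
  norm_num at this

/-- The uniform mixture over all subsets is a product of symmetric two-point mixtures. -/
theorem average_prod_ite {n : ℕ} (a b : Fin n → ℝ) :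
    1 / ((Finset.univ : Finset (Finset (Fin n))).card : ℝ) *
      ∑ S : Finset (Fin n), ∏ i, (if i ∈ S then a i else b i) = ∏ i, (b i + a i) / 2 := by
  rw [Finset.prod_div_distrib, Finset.prod_const]
  simp_rw [add_comm (b _), Fintype.prod_add]
  simp only [Finset.card_univ, Fintype.card_finset, Fintype.card_fin, Nat.cast_pow,
    Nat.cast_ofNat]
  rw [div_mul_eq_mul_div, one_mul]
  congr 1
  refine Finset.sum_congr rfl fun S _ ↦ ?_
  rw [← Finset.prod_mul_prod_compl S]
  congr 1
  · exact Finset.prod_congr rfl fun i hi ↦ if_pos hi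
  · exact Finset.prod_congr rfl fun i hi ↦ if_neg (Finset.mem_compl.1 hi)

/-- For every `ε ∈ (0,1)` there exist `n`, `μ > 0` and classes
`A ⊆ C` of subsets of `{1,...,n}` such that the Bayes risks
`R*_D(μ) = 1 - (1/2)∫|φ₀ - (1/|D|)∑_{S∈D} φ_S|` satisfy `R*_A(μ) ≥ 1 - ε`
and `R*_C(μ) ≤ 2ε`: the Bayes risk is not monotone under inclusion. -/
theorem stmt16 (ε : ℝ) (hε : ε ∈ Set.Ioo (0:ℝ) 1) :
    ∃ (n : ℕ) (μ : ℝ) (A C : Finset (Finset (Fin n))),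
      0 < n ∧ 0 < μ ∧ A.Nonempty ∧ A ⊆ C ∧
      (1 - ε ≤ 1 - (1/2) * ∫ x : Fin n → ℝ,
          |(2 * π) ^ (-(n : ℝ) / 2) * Real.exp (-(∑ i, (x i)^2) / 2) -
            (1 / (A.card : ℝ)) * ∑ S ∈ A, (2 * π) ^ (-(n : ℝ) / 2) *
              Real.exp (-(∑ i, (x i - if i ∈ S then μ else 0)^2) / 2)|) ∧
      (1 - (1/2) * ∫ x : Fin n → ℝ,
          |(2 * π) ^ (-(n : ℝ) / 2) * Real.exp (-(∑ i, (x i)^2) / 2) -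
            (1 / (C.card : ℝ)) * ∑ S ∈ C, (2 * π) ^ (-(n : ℝ) / 2) *
              Real.exp (-(∑ i, (x i - if i ∈ S then μ else 0)^2) / 2)|
        ≤ 2 * ε) := by
  obtain ⟨hε0, hε1⟩ := hε
  set f := gaussianPDFReal 0 1 with hf_def
  set h := gaussianPDFReal 1 1 with hh_def
  have hf0 : ∀ x, 0 < f x := fun x ↦ gaussianPDFReal_pos 0 1 x one_ne_zero
  have hh0 : ∀ x, 0 < h x := fun x ↦ gaussianPDFReal_pos 1 1 x one_ne_zero
  have hf : Integrable f := integrable_gaussianPDFReal 0 1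
  have hh : Integrable h := integrable_gaussianPDFReal 1 1
  have hf1 : ∫ x, f x = 1 := integral_gaussianPDFReal_eq_one 0 one_ne_zero
  have hh1 : ∫ x, h x = 1 := integral_gaussianPDFReal_eq_one 1 one_ne_zero
  have hw : Integrable fun x ↦ h x ^ 2 / f x := by
    simp_rw [hf_def, hh_def, gaussianPDFReal_sq_div]
    exact (integrable_gaussianPDFReal 2 1).const_mul _
  have hm0 : ∀ x, 0 ≤ (f x + h x) / 2 := fun x ↦ by linarith [hf0 x, hh0 x]
  have hm : Integrable fun x ↦ (f x + h x) / 2 := (hf.add hh).div_const 2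
  have hm1 : ∫ x, (f x + h x) / 2 = 1 := by
    rw [integral_div, integral_add hf hh, hf1, hh1]
    norm_num
  have hρ : ∫ t, √(f t * ((f t + h t) / 2)) < 1 := by
    have hfc : Continuous f := continuous_gaussianPDFReal 0
    have hhc : Continuous h := continuous_gaussianPDFReal 1
    refine integral_sqrt_mul_lt_one (a := 0) (fun x ↦ (hf0 x).le) hm0 hfc
      (by fun_prop) hf hm hf1 hm1 fun h0 ↦ ?_
    exact gaussianPDFReal_zero_ne_one (by linarith : f 0 = h 0)
  have hρ0 : 0 ≤ ∫ t, √(f t * ((f t + h t) / 2)) := integral_nonneg fun _ ↦ Real.sqrt_nonneg _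
  set V := ∫ t, (f t - h t) ^ 2 / f t
  obtain ⟨n, hnρ, hnV, hn⟩ := (((tendsto_pow_atTop_nhds_zero_of_lt_one hρ0 hρ).eventually_le_const
    (by linarith : 0 < 2 * ε)).and ((tendsto_natCast_atTop_atTop.eventually_ge_atTop
      (V / ε ^ 2)).and (Filter.eventually_gt_atTop 0))).exists
  have hn' : (0 : ℝ) < n := by exact_mod_cast hn
  have h_null : ∀ x : Fin n → ℝ, (2 * π) ^ (-(n : ℝ) / 2) * Real.exp (-(∑ i, (x i) ^ 2) / 2) =
      ∏ i, f (x i) := fun x ↦ by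
    simpa using prod_gaussianPDFReal_shift x fun _ ↦ 0
  have h_alt : ∀ (S : Finset (Fin n)) (x : Fin n → ℝ), (2 * π) ^ (-(n : ℝ) / 2) *
      Real.exp (-(∑ i, (x i - if i ∈ S then (1 : ℝ) else 0) ^ 2) / 2) =
      ∏ i, if i ∈ S then h (x i) else f (x i) := fun S x ↦ by
    rw [prod_gaussianPDFReal_shift x fun i ↦ if i ∈ S then (1 : ℝ) else 0]
    refine Finset.prod_congr rfl fun i _ ↦ ?_
    split_ifs <;> rfl
  refine ⟨n, 1, Finset.univ.map ⟨singleton, Finset.singleton_injective⟩, Finset.univ, hn,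
    one_pos, ?_, Finset.subset_univ _, ?_, ?_⟩
  · exact (Finset.univ_nonempty_iff.2 ⟨⟨0, hn⟩⟩).map
  · simp only [h_alt]
    simp only [h_null, Finset.sum_map, Finset.card_map, Function.Embedding.coeFn_mk,
      Finset.mem_singleton, Finset.card_univ, Fintype.card_fin]
    have := integral_abs_prod_sub_average_le hn hf0 hf hh hf1 hh1 hw hε0
    have hV : V / (2 * n * ε) ≤ ε / 2 := by
      rw [div_le_iff₀ (by positivity)] at hnV
      rw [div_le_iff₀ (by positivity)]
      linarith
    linarith
  · simp only [h_alt]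
    simp only [h_null, average_prod_ite]
    exact (one_sub_half_integral_abs_prod_sub_prod_le (fun x ↦ (hf0 x).le) hm0 hf hm hf1
      hm1).trans hnρ
end

section
/- Let C be a family of K-subsets of {1,...,n} and f* the Bayes-optimal test, which rejects iff (1/N)∑_{S∈C}exp(μX_S) > exp(Kμ²/2). Then for any δ ∈ (0,1), the type I error satisfies P₀{f*(X) = 1} ≤ exp(-(Kμ/2 - M_C(μ))²/(2K)) whenever Kμ/2 ≥ M_C(μ), where M_C(μ) = E₀[(1/μ)log((1/N)∑_{S∈C}exp(μX_S))]. Consequently P₀{f*(X)=1} ≤ δ whenever μ ≥ 2M_C(μ)/K + √((8/K)·log(1/δ)). -/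
open MeasureTheory Real Finset ProbabilityTheory

/-- The standard Gaussian measure on `Fin n → ℝ`. -/
noncomputable abbrev stdGaussianPi (n : ℕ) : Measure (Fin n → ℝ) :=
  Measure.pi fun _ : Fin n => gaussianReal 0 1

instance isGaussian_stdGaussianPi (n : ℕ) : IsGaussian (stdGaussianPi n) := by
  have hind : iIndepFun (fun (i : Fin n) (x : Fin n → ℝ) => x i) (stdGaussianPi n) :=
    iIndepFun_pi (X := fun (_ : Fin n) (x : ℝ) => x) (fun _ => aemeasurable_id)
  have h := hind.hasGaussianLaw (fun i => ⟨by
    have := (measurePreserving_eval (fun _ : Fin n => gaussianReal 0 1) i).map_eq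
    change IsGaussian (Measure.map (Function.eval i) (stdGaussianPi n))
    rw [this]
    infer_instance⟩)
  simpa using h.isGaussian_map

lemma integral_id_stdGaussianPi (n : ℕ) : ∫ x, id x ∂(stdGaussianPi n) = 0 := by
  ext i
  have hi : Integrable (fun x : Fin n → ℝ => id x) (stdGaussianPi n) := IsGaussian.integrable_id
  rw [eval_integral (fun i => hi.eval i)]
  have := integral_comp_eval (μ := fun _ : Fin n => gaussianReal 0 1) (i := i)
    (f := fun x : ℝ => x) (by fun_prop)
  simpa using this

lemma integrable_exp_mul_norm_stdGaussianPi (n : ℕ) (t : ℝ) :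
    Integrable (fun x => exp (t * ‖x‖)) (stdGaussianPi n) := by
  obtain ⟨C, hC, hint⟩ := IsGaussian.exists_integrable_exp_sq (stdGaussianPi n)
  refine (hint.const_mul (exp (t ^ 2 / (4 * C)))).mono' (by fun_prop) (ae_of_all _ fun x => ?_)
  rw [norm_eq_abs, abs_of_pos (exp_pos _), ← exp_add, exp_le_exp]
  have : t ^ 2 / (4 * C) + C * ‖x‖ ^ 2 - t * ‖x‖ = (t - 2 * C * ‖x‖) ^ 2 / (4 * C) := by
    field_simp
    ring
  have : 0 ≤ (t - 2 * C * ‖x‖) ^ 2 / (4 * C) := by positivity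
  linarith

lemma integrable_exp_mul_norm_prod_stdGaussianPi (n : ℕ) (t : ℝ) :
    Integrable (fun z : (Fin n → ℝ) × (Fin n → ℝ) => exp (t * (‖z.1‖ + ‖z.2‖)))
      ((stdGaussianPi n).prod (stdGaussianPi n)) := by
  simpa only [mul_add, exp_add] using
    (integrable_exp_mul_norm_stdGaussianPi n t).mul_prod (integrable_exp_mul_norm_stdGaussianPi n t)

lemma hasDerivAt_gaussianPDFReal_zero_one (x : ℝ) :
    HasDerivAt (gaussianPDFReal 0 1) (-x * gaussianPDFReal 0 1 x) x := by
  have h : HasDerivAt (fun x : ℝ => (√(2 * π * (1 : NNReal)))⁻¹ *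
      exp (-(x - 0) ^ 2 / (2 * (1 : NNReal))))
      ((√(2 * π * (1 : NNReal)))⁻¹ * (exp (-(x - 0) ^ 2 / (2 * (1 : NNReal))) *
        (-(2 * (x - 0)) / (2 * (1 : NNReal))))) x := by
    refine HasDerivAt.const_mul _ (HasDerivAt.exp ?_)
    refine HasDerivAt.div_const (HasDerivAt.neg ?_) _
    simpa using ((hasDerivAt_id' x).sub_const 0).fun_pow 2
  convert! h using 1
  simp [gaussianPDFReal]
  ring

/-- Stein's identity: Gaussian integration by parts on the line. -/
lemma integral_id_mul_gaussianReal {f f' : ℝ → ℝ} (hf : ∀ x, HasDerivAt f (f' x) x)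
    (h0 : Integrable f (gaussianReal 0 1)) (h1 : Integrable f' (gaussianReal 0 1))
    (h2 : Integrable (fun x => x * f x) (gaussianReal 0 1)) :
    ∫ x, x * f x ∂(gaussianReal 0 1) = ∫ x, f' x ∂(gaussianReal 0 1) := by
  have key : ∀ g : ℝ → ℝ, Integrable g (gaussianReal 0 1) →
      Integrable (fun x => gaussianPDFReal 0 1 x * g x) := by
    intro g hg
    rw [gaussianReal_of_var_ne_zero 0 one_ne_zero, integrable_withDensity_iff_integrable_smul'
      (measurable_gaussianPDF _ _) (ae_of_all _ fun _ => gaussianPDF_lt_top)] at hg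
    simpa using hg
  rw [integral_gaussianReal_eq_integral_smul one_ne_zero,
    integral_gaussianReal_eq_integral_smul one_ne_zero]
  have := integral_mul_deriv_eq_deriv_mul_of_integrable (u := gaussianPDFReal 0 1) (v := f)
    (u' := fun x => -x * gaussianPDFReal 0 1 x) (v' := f')
    (fun x _ => hasDerivAt_gaussianPDFReal_zero_one x) (fun x _ => hf x) (key _ h1)
    ((key _ h2).neg.congr (ae_of_all _ fun x => by simp; ring)) (key _ h0)
  simp only [smul_eq_mul]
  rw [this, ← integral_neg]
  congr with x
  ring

/-- Gaussian integration by parts in one coordinate of `Fin n → ℝ`. -/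
lemma integral_eval_mul_stdGaussianPi {n : ℕ} (i : Fin n) {G G' : (Fin n → ℝ) → ℝ}
    (hG : ∀ x, HasDerivAt (fun t => G (Function.update x i t)) (G' x) (x i))
    (h0 : Integrable G (stdGaussianPi n)) (h1 : Integrable G' (stdGaussianPi n))
    (h2 : Integrable (fun x => x i * G x) (stdGaussianPi n)) :
    ∫ x, x i * G x ∂(stdGaussianPi n) = ∫ x, G' x ∂(stdGaussianPi n) := by
  obtain _ | n := n
  · exact i.elim0
  have mp := (measurePreserving_piFinSuccAbove (fun _ : Fin (n + 1) => gaussianReal 0 1) i).symm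
  have hint : ∀ {f : (Fin (n + 1) → ℝ) → ℝ}, Integrable f (stdGaussianPi (n + 1)) →
      Integrable (fun z : ℝ × (Fin n → ℝ) => f (i.insertNth z.1 z.2))
        ((gaussianReal 0 1).prod (stdGaussianPi n)) := fun hf =>
    (mp.integrable_comp_emb (MeasurableEquiv.measurableEmbedding _)).2 hf
  have hcomp : ∀ {f : (Fin (n + 1) → ℝ) → ℝ}, Integrable f (stdGaussianPi (n + 1)) →
      ∫ x, f x ∂(stdGaussianPi (n + 1)) =
        ∫ y, ∫ t, f (i.insertNth t y) ∂(gaussianReal 0 1) ∂(stdGaussianPi n) := by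
    intro f hf
    rw [← mp.integral_comp' f]
    exact integral_prod_symm _ (hint hf)
  rw [hcomp h2, hcomp h1]
  refine integral_congr_ae ?_
  filter_upwards [(hint h0).prod_left_ae, (hint h1).prod_left_ae, (hint h2).prod_left_ae]
    with y hy0 hy1 hy2
  simp only [Fin.insertNth_apply_same] at hy2 ⊢
  refine integral_id_mul_gaussianReal (fun t => ?_) hy0 hy1 hy2
  simpa using hG (i.insertNth t y)

lemma integral_comp_rotation_stdGaussianPi {n : ℕ} (θ : ℝ) {f : (Fin n → ℝ) × (Fin n → ℝ) → ℝ}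
    (hf : Continuous f) :
    ∫ z, f (cos θ • z.1 + sin θ • z.2, -sin θ • z.1 + cos θ • z.2)
        ∂((stdGaussianPi n).prod (stdGaussianPi n)) =
      ∫ z, f z ∂((stdGaussianPi n).prod (stdGaussianPi n)) := by
  have h := integral_map (μ := (stdGaussianPi n).prod (stdGaussianPi n))
    (φ := ContinuousLinearMap.rotation θ) (f := f)
    (ContinuousLinearMap.rotation θ).continuous.aemeasurable hf.aestronglyMeasurable
  rw [IsGaussian.map_rotation_eq_self (integral_id_stdGaussianPi n) θ] at h
  exact h.symm

lemma integral_sum_mul_comp_stdGaussianPi {n : ℕ} {F : (Fin n → ℝ) → ℝ}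
    {q : (Fin n → ℝ) → Fin n → ℝ} {A t : ℝ} (ht : 0 ≤ t)
    (hF : ∀ x (i : Fin n), HasDerivAt (fun r => F (Function.update x i r)) (q x i) (x i))
    (hFc : Continuous F) (hqc : Continuous q)
    (hFA : ∀ x, |F x| ≤ A * exp (t * ‖x‖)) (hqA : ∀ x i, |q x i| ≤ A * exp (t * ‖x‖))
    (a w : Fin n → ℝ) (s : ℝ) :
    ∫ v, (∑ i, a i * v i) * F (w - s • v) ∂(stdGaussianPi n) =
      ∫ v, -s * ∑ i, a i * q (w - s • v) i ∂(stdGaussianPi n) := by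
  have hA : 0 ≤ A := by
    have := (abs_nonneg _).trans (hFA 0)
    simpa using this
  have hnorm : ∀ v : Fin n → ℝ, t * ‖w - s • v‖ ≤ t * ‖w‖ + t * |s| * ‖v‖ := by
    intro v
    calc t * ‖w - s • v‖ ≤ t * (‖w‖ + ‖s • v‖) := by gcongr; exact norm_sub_le _ _
      _ = t * ‖w‖ + t * |s| * ‖v‖ := by rw [norm_smul, norm_eq_abs]; ring
  have hbd : ∀ v : Fin n → ℝ, A * exp (t * ‖w - s • v‖) ≤
      A * exp (t * ‖w‖) * exp (t * |s| * ‖v‖) := by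
    intro v
    rw [mul_assoc, ← exp_add]
    gcongr
    exact hnorm v
  have h0 : Integrable (fun v => F (w - s • v)) (stdGaussianPi n) :=
    ((integrable_exp_mul_norm_stdGaussianPi n (t * |s|)).const_mul (A * exp (t * ‖w‖))).mono'
      (by fun_prop) (ae_of_all _ fun v => (hFA _).trans (hbd v))
  have h1 : ∀ i, Integrable (fun v => q (w - s • v) i) (stdGaussianPi n) := fun i =>
    ((integrable_exp_mul_norm_stdGaussianPi n (t * |s|)).const_mul (A * exp (t * ‖w‖))).mono'
      (by fun_prop) (ae_of_all _ fun v => (hqA _ i).trans (hbd v))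
  have h2 : ∀ i, Integrable (fun v => v i * F (w - s • v)) (stdGaussianPi n) := fun i => by
    refine ((integrable_exp_mul_norm_stdGaussianPi n (t * |s| + 1)).const_mul
      (A * exp (t * ‖w‖))).mono' (by fun_prop) (ae_of_all _ fun v => ?_)
    have e1 : |v i| ≤ exp ‖v‖ :=
      (norm_le_pi_norm v i).trans (by linarith [add_one_le_exp ‖v‖])
    calc ‖v i * F (w - s • v)‖ = |v i| * |F (w - s • v)| := by rw [norm_eq_abs, abs_mul]
      _ ≤ exp ‖v‖ * (A * exp (t * ‖w‖) * exp (t * |s| * ‖v‖)) := by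
          gcongr
          exact (hFA _).trans (hbd v)
      _ = A * exp (t * ‖w‖) * exp ((t * |s| + 1) * ‖v‖) := by rw [add_mul, exp_add]; ring_nf
  have key : ∀ i, ∫ v, v i * F (w - s • v) ∂(stdGaussianPi n) =
      ∫ v, -s * q (w - s • v) i ∂(stdGaussianPi n) := fun i => by
    refine integral_eval_mul_stdGaussianPi i (fun v => ?_) h0 ((h1 i).const_mul _) (h2 i)
    have e : ∀ r, w - s • Function.update v i r =
        Function.update (w - s • v) i (w i - s * r) := by
      intro r
      ext j
      by_cases hj : j = i
      · subst hj; simp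
      · simp [hj]
    simp_rw [e]
    have hd : HasDerivAt (fun r => w i - s * r) (-s) (v i) := by
      simpa using ((hasDerivAt_id' (v i)).const_mul s).const_sub (w i)
    have := HasDerivAt.comp (v i) (h := fun r => w i - s * r)
      (h₂ := fun r => F (Function.update (w - s • v) i r)) (hF (w - s • v) i) hd
    rw [mul_comm]
    exact this
  simp only [Finset.sum_mul, Finset.mul_sum]
  rw [integral_finsetSum _ fun i _ => ?_, integral_finsetSum _ fun i _ => ?_]
  · refine Finset.sum_congr rfl fun i _ => ?_
    simp only [mul_assoc, mul_left_comm (-s)]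
    rw [integral_const_mul, integral_const_mul, key]
  · exact ((h1 i).const_mul _).const_mul _
  · simpa only [mul_assoc] using (h2 i).const_mul (a i)

/-- A covariance estimate for the standard Gaussian measure: if the inner product of the gradient
`p` of `g` at one point with the gradient `q` of `F` at another one is at most `L` times the value
of `F` at the latter, then `Cov(g, F) ≤ L * E F`. -/
lemma integral_mul_sub_le_stdGaussianPi {n : ℕ} {g F : (Fin n → ℝ) → ℝ}
    {p q : (Fin n → ℝ) → Fin n → ℝ} {A B t L : ℝ} (ht : 0 ≤ t)
    (hg : ∀ x, HasFDerivAt g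
      (∑ i, p x i • ContinuousLinearMap.proj (R := ℝ) (φ := fun _ : Fin n => ℝ) i) x)
    (hF : ∀ x (i : Fin n), HasDerivAt (fun r => F (Function.update x i r)) (q x i) (x i))
    (hFc : Continuous F) (hpc : Continuous p) (hqc : Continuous q)
    (hgA : ∀ x, |g x| ≤ A * exp (t * ‖x‖)) (hpB : ∀ x i, |p x i| ≤ B)
    (hFA : ∀ x, |F x| ≤ A * exp (t * ‖x‖)) (hqA : ∀ x i, |q x i| ≤ A * exp (t * ‖x‖))
    (hL : ∀ x y, ∑ i, p x i * q y i ≤ L * F y) :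
    ∫ x, g x * F x ∂(stdGaussianPi n) -
      (∫ x, g x ∂(stdGaussianPi n)) * ∫ x, F x ∂(stdGaussianPi n) ≤
      L * ∫ x, F x ∂(stdGaussianPi n) := by
  have hgc : Continuous g := continuous_iff_continuousAt.2 fun x => (hg x).continuousAt
  have hA : 0 ≤ A := by simpa using (abs_nonneg _).trans (hFA 0)
  have hFint : Integrable F (stdGaussianPi n) :=
    ((integrable_exp_mul_norm_stdGaussianPi n t).const_mul A).mono'
      hFc.aestronglyMeasurable (ae_of_all _ hFA)
  have hsum : ∀ u v : Fin n → ℝ, |∑ i, p u i * v i| ≤ n * |B| * ‖v‖ := by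
    intro u v
    calc |∑ i, p u i * v i| ≤ ∑ i, |p u i * v i| := Finset.abs_sum_le_sum_abs _ _
      _ ≤ ∑ _i : Fin n, |B| * ‖v‖ := by
        refine Finset.sum_le_sum fun i _ => ?_
        rw [abs_mul]
        exact mul_le_mul ((hpB u i).trans (le_abs_self B)) (norm_le_pi_norm v i)
          (abs_nonneg _) (abs_nonneg _)
      _ = n * |B| * ‖v‖ := by simp [mul_assoc]
  have hlin : ∀ a b : ℝ, |a| ≤ 1 → |b| ≤ 1 → ∀ x y : Fin n → ℝ,
      ‖a • x + b • y‖ ≤ ‖x‖ + ‖y‖ := by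
    intro a b ha hb x y
    refine (norm_add_le _ _).trans (add_le_add ?_ ?_) <;> rw [norm_smul, norm_eq_abs]
    · exact mul_le_of_le_one_left (norm_nonneg _) ha
    · exact mul_le_of_le_one_left (norm_nonneg _) hb
  have hFA' : ∀ x y z : Fin n → ℝ, ‖x‖ ≤ ‖y‖ + ‖z‖ → |F x| ≤ A * exp (t * (‖y‖ + ‖z‖)) := by
    intro x y z h
    exact (hFA x).trans (by gcongr)
  set ψ' : ℝ → (Fin n → ℝ) × (Fin n → ℝ) → ℝ := fun θ z =>
    (∑ i, p (cos θ • z.1 + sin θ • z.2) i * (-sin θ • z.1 + cos θ • z.2) i) * F z.1 with hψ'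
  have hd : ∀ θ, HasDerivAt
      (fun θ => ∫ z, g (cos θ • z.1 + sin θ • z.2) * F z.1
        ∂((stdGaussianPi n).prod (stdGaussianPi n)))
      (∫ z, ψ' θ z ∂((stdGaussianPi n).prod (stdGaussianPi n))) θ := by
    intro θ
    refine (hasDerivAt_integral_of_dominated_loc_of_deriv_le (s := Set.univ)
      (bound := fun z => n * |B| * A * exp ((t + 1) * (‖z.1‖ + ‖z.2‖)))
      Filter.univ_mem (Filter.Eventually.of_forall fun θ => ?_) ?_ ?_ ?_ ?_ ?_).2
    · exact Continuous.aestronglyMeasurable (by fun_prop)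
    · refine ((integrable_exp_mul_norm_prod_stdGaussianPi n (2 * t)).const_mul (A * A)).mono'
        (Continuous.aestronglyMeasurable (by fun_prop)) (ae_of_all _ fun z => ?_)
      calc ‖g (cos θ • z.1 + sin θ • z.2) * F z.1‖
          = |g (cos θ • z.1 + sin θ • z.2)| * |F z.1| := by rw [norm_eq_abs, abs_mul]
        _ ≤ (A * exp (t * (‖z.1‖ + ‖z.2‖))) * (A * exp (t * (‖z.1‖ + ‖z.2‖))) := by
          gcongr
          · refine (hgA _).trans ?_
            gcongr
            exact hlin _ _ (abs_cos_le_one θ) (abs_sin_le_one θ) _ _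
          · exact hFA' _ _ _ (by linarith [norm_nonneg z.2])
        _ = A * A * exp (2 * t * (‖z.1‖ + ‖z.2‖)) := by
          rw [mul_mul_mul_comm, ← exp_add]; ring_nf
    · exact Continuous.aestronglyMeasurable (by fun_prop)
    · refine ae_of_all _ fun z θ _ => ?_
      calc ‖ψ' θ z‖ = |∑ i, p (cos θ • z.1 + sin θ • z.2) i * (-sin θ • z.1 + cos θ • z.2) i| *
            |F z.1| := by rw [norm_eq_abs, abs_mul]
        _ ≤ (n * |B| * exp (‖z.1‖ + ‖z.2‖)) * (A * exp (t * (‖z.1‖ + ‖z.2‖))) := by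
          gcongr
          · refine (hsum _ _).trans ?_
            gcongr
            refine (hlin _ _ (by simpa using abs_sin_le_one θ) (abs_cos_le_one θ) _ _).trans ?_
            linarith [add_one_le_exp (‖z.1‖ + ‖z.2‖)]
          · exact hFA' _ _ _ (by linarith [norm_nonneg z.2])
        _ = n * |B| * A * exp ((t + 1) * (‖z.1‖ + ‖z.2‖)) := by
          rw [mul_mul_mul_comm, ← exp_add]; ring_nf
    · exact (integrable_exp_mul_norm_prod_stdGaussianPi n (t + 1)).const_mul _
    · refine ae_of_all _ fun z θ _ => ?_
      have hin : HasDerivAt (fun θ : ℝ => cos θ • z.1 + sin θ • z.2)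
          (-sin θ • z.1 + cos θ • z.2) θ :=
        ((hasDerivAt_cos θ).smul_const z.1).add ((hasDerivAt_sin θ).smul_const z.2)
      have := ((hg _).comp_hasDerivAt θ hin).mul_const (F z.1)
      simpa [hψ', _root_.sum_apply] using! this
  have hlow : ∀ θ, 0 ≤ sin θ → -sin θ * (L * ∫ x, F x ∂(stdGaussianPi n)) ≤
      ∫ z, ψ' θ z ∂((stdGaussianPi n).prod (stdGaussianPi n)) := by
    intro θ hs
    have hsub : ∀ u v : Fin n → ℝ, ‖cos θ • u - sin θ • v‖ ≤ ‖u‖ + ‖v‖ := by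
      intro u v
      rw [sub_eq_add_neg, ← neg_smul]
      exact hlin _ _ (abs_cos_le_one θ) (by simpa using abs_sin_le_one θ) _ _
    have hrot : ∀ z : (Fin n → ℝ) × (Fin n → ℝ), cos θ • (cos θ • z.1 + sin θ • z.2) -
        sin θ • (-sin θ • z.1 + cos θ • z.2) = z.1 := by
      intro z
      ext i
      simp only [Pi.sub_apply, Pi.add_apply, Pi.smul_apply, smul_eq_mul]
      linear_combination z.1 i * cos_sq_add_sin_sq θ
    have hH : ∫ z, ψ' θ z ∂((stdGaussianPi n).prod (stdGaussianPi n)) =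
        ∫ z, (∑ i, p z.1 i * z.2 i) * F (cos θ • z.1 - sin θ • z.2)
          ∂((stdGaussianPi n).prod (stdGaussianPi n)) := by
      rw [← integral_comp_rotation_stdGaussianPi θ (f := fun z =>
        (∑ i, p z.1 i * z.2 i) * F (cos θ • z.1 - sin θ • z.2)) (by fun_prop)]
      simp only [hrot, hψ']
    have hE : ∫ x, F x ∂(stdGaussianPi n) =
        ∫ z : (Fin n → ℝ) × (Fin n → ℝ), F (cos θ • z.1 - sin θ • z.2)
          ∂((stdGaussianPi n).prod (stdGaussianPi n)) := by
      rw [← integral_comp_rotation_stdGaussianPi θ (f := fun z =>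
        F (cos θ • z.1 - sin θ • z.2)) (by fun_prop)]
      simp only [hrot]
      rw [integral_fun_fst]
      simp
    have hi1 : Integrable (fun z : (Fin n → ℝ) × (Fin n → ℝ) =>
        (∑ i, p z.1 i * z.2 i) * F (cos θ • z.1 - sin θ • z.2))
        ((stdGaussianPi n).prod (stdGaussianPi n)) := by
      refine ((integrable_exp_mul_norm_prod_stdGaussianPi n (t + 1)).const_mul
        (n * |B| * A)).mono' (Continuous.aestronglyMeasurable (by fun_prop))
        (ae_of_all _ fun z => ?_)
      calc ‖(∑ i, p z.1 i * z.2 i) * F (cos θ • z.1 - sin θ • z.2)‖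
          = |∑ i, p z.1 i * z.2 i| * |F (cos θ • z.1 - sin θ • z.2)| := by
            rw [norm_eq_abs, abs_mul]
        _ ≤ (n * |B| * exp (‖z.1‖ + ‖z.2‖)) * (A * exp (t * (‖z.1‖ + ‖z.2‖))) := by
          gcongr
          · refine (hsum _ _).trans ?_
            gcongr
            linarith [add_one_le_exp (‖z.1‖ + ‖z.2‖), norm_nonneg z.1]
          · exact hFA' _ _ _ (hsub _ _)
        _ = n * |B| * A * exp ((t + 1) * (‖z.1‖ + ‖z.2‖)) := by
          rw [mul_mul_mul_comm, ← exp_add]; ring_nf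
    have hi2 : Integrable (fun z : (Fin n → ℝ) × (Fin n → ℝ) =>
        -sin θ * L * F (cos θ • z.1 - sin θ • z.2))
        ((stdGaussianPi n).prod (stdGaussianPi n)) :=
      (((integrable_exp_mul_norm_prod_stdGaussianPi n t).const_mul A).mono'
        (Continuous.aestronglyMeasurable (by fun_prop))
        (ae_of_all _ fun z => hFA' _ _ _ (hsub _ _))).const_mul _
    rw [hH, hE, ← mul_assoc, ← integral_const_mul, integral_prod _ hi1, integral_prod _ hi2]
    refine integral_mono_ae hi2.integral_prod_left hi1.integral_prod_left ?_
    filter_upwards [hi2.prod_right_ae] with u hu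
    rw [integral_sum_mul_comp_stdGaussianPi ht hF hFc hqc hFA hqA]
    refine integral_mono hu ?_ fun v => ?_
    · refine Integrable.const_mul (integrable_finsetSum _ fun i _ => Integrable.const_mul ?_ _) _
      refine ((integrable_exp_mul_norm_stdGaussianPi n t).const_mul (A * exp (t * ‖u‖))).mono'
        (Continuous.aestronglyMeasurable (by fun_prop)) (ae_of_all _ fun v => ?_)
      refine (hqA _ i).trans ?_
      rw [mul_assoc, ← exp_add, ← mul_add]
      gcongr
      exact hsub u v
    · have := mul_le_mul_of_nonneg_left (hL u (cos θ • u - sin θ • v)) hs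
      simp only
      linarith
  have hmono : MonotoneOn (fun θ => (∫ z, g (cos θ • z.1 + sin θ • z.2) * F z.1
        ∂((stdGaussianPi n).prod (stdGaussianPi n))) -
        cos θ * (L * ∫ x, F x ∂(stdGaussianPi n))) (Set.Icc 0 (π / 2)) := by
    have hd2 := fun θ => (hd θ).sub ((hasDerivAt_cos θ).mul_const
      (L * ∫ x, F x ∂(stdGaussianPi n)))
    refine monotoneOn_of_deriv_nonneg (convex_Icc _ _)
      (fun θ _ => (hd2 θ).continuousAt.continuousWithinAt)
      (fun θ _ => (hd2 θ).differentiableAt.differentiableWithinAt) fun θ hθ => ?_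
    rw [interior_Icc] at hθ
    have := hlow θ (sin_nonneg_of_nonneg_of_le_pi hθ.1.le (by linarith [hθ.2, pi_pos]))
    refine le_of_le_of_eq ?_ (hd2 θ).deriv.symm
    linarith
  have h := hmono (Set.left_mem_Icc.2 (by positivity)) (Set.right_mem_Icc.2 (by positivity))
    (by positivity)
  have hprod : ∫ z : (Fin n → ℝ) × (Fin n → ℝ), g z.2 * F z.1
      ∂((stdGaussianPi n).prod (stdGaussianPi n)) =
      (∫ x, F x ∂(stdGaussianPi n)) * ∫ x, g x ∂(stdGaussianPi n) := by
    rw [← integral_prod_mul]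
    simp only [mul_comm]
  simp only [cos_zero, sin_zero, cos_pi_div_two, sin_pi_div_two, one_smul, zero_smul, add_zero,
    zero_add, zero_mul, sub_zero, one_mul, hprod] at h
  rw [integral_fun_fst (fun x => g x * F x)] at h
  simp only [probReal_univ, one_smul] at h
  linarith

lemma abs_le_add_mul_norm_of_gradient_bound {n : ℕ} {g : (Fin n → ℝ) → ℝ}
    {p : (Fin n → ℝ) → Fin n → ℝ} {B : ℝ}
    (hg : ∀ x, HasFDerivAt g
      (∑ i, p x i • ContinuousLinearMap.proj (R := ℝ) (φ := fun _ : Fin n => ℝ) i) x)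
    (hpB : ∀ x i, |p x i| ≤ B) (x : Fin n → ℝ) :
    |g x| ≤ |g 0| + n * |B| * ‖x‖ := by
  have hD : ∀ y, ‖∑ i, p y i • ContinuousLinearMap.proj (R := ℝ) (φ := fun _ : Fin n => ℝ) i‖ ≤
      n * |B| := by
    intro y
    refine ContinuousLinearMap.opNorm_le_bound _ (by positivity) fun v => ?_
    simp only [_root_.sum_apply, _root_.smul_apply,
      ContinuousLinearMap.proj_apply, smul_eq_mul, norm_eq_abs]
    calc |∑ i, p y i * v i| ≤ ∑ i, |p y i * v i| := Finset.abs_sum_le_sum_abs _ _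
      _ ≤ ∑ _i : Fin n, |B| * ‖v‖ := by
        refine Finset.sum_le_sum fun i _ => ?_
        rw [abs_mul]
        exact mul_le_mul ((hpB y i).trans (le_abs_self B)) (norm_le_pi_norm v i)
          (abs_nonneg _) (abs_nonneg _)
      _ = n * |B| * ‖v‖ := by simp [mul_assoc]
  have := convex_univ.norm_image_sub_le_of_norm_hasFDerivWithin_le
    (fun y _ => (hg y).hasFDerivWithinAt) (fun y _ => hD y) (Set.mem_univ 0) (Set.mem_univ x)
  rw [sub_zero, norm_eq_abs] at this
  linarith [abs_sub_abs_le_abs_sub (g x) (g 0)]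

lemma integrable_exp_mul_of_gradient_bound {n : ℕ} {g : (Fin n → ℝ) → ℝ}
    {p : (Fin n → ℝ) → Fin n → ℝ} {B : ℝ}
    (hg : ∀ x, HasFDerivAt g
      (∑ i, p x i • ContinuousLinearMap.proj (R := ℝ) (φ := fun _ : Fin n => ℝ) i) x)
    (hpB : ∀ x i, |p x i| ≤ B) (l : ℝ) :
    Integrable (fun x => exp (l * g x)) (stdGaussianPi n) := by
  have hgc : Continuous g := continuous_iff_continuousAt.2 fun x => (hg x).continuousAt
  refine ((integrable_exp_mul_norm_stdGaussianPi n (|l| * (n * |B|))).const_mul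
    (exp (|l| * |g 0|))).mono' (by fun_prop) (ae_of_all _ fun x => ?_)
  rw [norm_eq_abs, abs_of_pos (exp_pos _), ← exp_add, exp_le_exp]
  calc l * g x ≤ |l| * |g x| := (le_abs_self _).trans (abs_mul _ _).le
    _ ≤ |l| * (|g 0| + n * |B| * ‖x‖) := by
      gcongr
      exact abs_le_add_mul_norm_of_gradient_bound hg hpB x
    _ = _ := by ring

lemma integral_mul_exp_le_stdGaussianPi {n : ℕ} {g : (Fin n → ℝ) → ℝ}
    {p : (Fin n → ℝ) → Fin n → ℝ} {B L : ℝ}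
    (hg : ∀ x, HasFDerivAt g
      (∑ i, p x i • ContinuousLinearMap.proj (R := ℝ) (φ := fun _ : Fin n => ℝ) i) x)
    (hpc : Continuous p) (hpB : ∀ x i, |p x i| ≤ B) (hL : ∀ x y, ∑ i, p x i * p y i ≤ L)
    {l : ℝ} (hl : 0 ≤ l) :
    ∫ x, g x * exp (l * g x) ∂(stdGaussianPi n) ≤
      (∫ x, g x ∂(stdGaussianPi n) + l * L) * ∫ x, exp (l * g x) ∂(stdGaussianPi n) := by
  have hgc : Continuous g := continuous_iff_continuousAt.2 fun x => (hg x).continuousAt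
  have hgr := abs_le_add_mul_norm_of_gradient_bound hg hpB
  have hexp : ∀ x, exp ((1 + l) * |g x|) ≤
      exp ((1 + l) * |g 0|) * exp ((1 + l) * (n * |B|) * ‖x‖) := by
    intro x
    rw [← exp_add, exp_le_exp]
    calc (1 + l) * |g x| ≤ (1 + l) * (|g 0| + n * |B| * ‖x‖) := by gcongr; exact hgr x
      _ = _ := by ring
  have hA : ∀ x, exp ((1 + l) * |g x|) ≤
      exp ((1 + l) * |g 0|) * (1 + l * |B|) * exp ((1 + l) * (n * |B|) * ‖x‖) := by
    intro x
    refine (hexp x).trans ?_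
    gcongr
    exact le_mul_of_one_le_right (exp_pos _).le (by linarith [mul_nonneg hl (abs_nonneg B)])
  have hle : ∀ x, exp (l * g x) ≤ exp ((1 + l) * |g x|) := by
    intro x
    rw [exp_le_exp]
    nlinarith [abs_nonneg (g x), mul_le_mul_of_nonneg_left (le_abs_self (g x)) hl]
  have := integral_mul_sub_le_stdGaussianPi (g := g) (F := fun x => exp (l * g x)) (p := p)
    (q := fun x i => l * p x i * exp (l * g x)) (B := B) (L := l * L)
    (A := exp ((1 + l) * |g 0|) * (1 + l * |B|)) (t := (1 + l) * (n * |B|)) (by positivity)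
    hg (fun x i => ?_) (by fun_prop) hpc (by fun_prop) (fun x => ?_) hpB (fun x => ?_)
    (fun x i => ?_) (fun x y => ?_)
  · linarith
  · have hgi : HasDerivAt (fun r => g (Function.update x i r)) (p x i) (x i) := by
      have h := (hg (Function.update x i (x i))).comp_hasDerivAt (x i)
        (hasDerivAt_update x i (x i))
      simpa [_root_.sum_apply, Pi.single_apply] using! h
    have := (hgi.const_mul l).exp
    rw [Function.update_eq_self] at this
    rwa [mul_comm] at this
  · refine le_trans ?_ (hA x)
    have := add_one_le_exp ((1 + l) * |g x|)
    nlinarith [abs_nonneg (g x), mul_nonneg hl (abs_nonneg (g x))]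
  · rw [abs_of_pos (exp_pos _)]
    exact (hle x).trans (hA x)
  · rw [abs_mul, abs_mul, abs_of_nonneg hl, abs_of_pos (exp_pos (l * g x))]
    have h1 : l * |p x i| ≤ 1 + l * |B| := by
      have := mul_le_mul_of_nonneg_left ((hpB x i).trans (le_abs_self B)) hl
      linarith
    calc l * |p x i| * exp (l * g x)
        ≤ (1 + l * |B|) * (exp ((1 + l) * |g 0|) * exp ((1 + l) * (n * |B|) * ‖x‖)) := by
          gcongr
          exact (hle x).trans (hexp x)
      _ = _ := by ring
  · have := mul_le_mul_of_nonneg_right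
      (mul_le_mul_of_nonneg_left (hL x y) hl) (exp_pos (l * g y)).le
    refine le_of_eq_of_le ?_ this
    rw [Finset.mul_sum, Finset.sum_mul]
    exact Finset.sum_congr rfl fun i _ => by ring

lemma cgf_le_stdGaussianPi {n : ℕ} {g : (Fin n → ℝ) → ℝ}
    {p : (Fin n → ℝ) → Fin n → ℝ} {B L : ℝ}
    (hg : ∀ x, HasFDerivAt g
      (∑ i, p x i • ContinuousLinearMap.proj (R := ℝ) (φ := fun _ : Fin n => ℝ) i) x)
    (hpc : Continuous p) (hpB : ∀ x i, |p x i| ≤ B) (hL : ∀ x y, ∑ i, p x i * p y i ≤ L)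
    {l : ℝ} (hl : 0 ≤ l) :
    cgf g (stdGaussianPi n) l ≤ l * ∫ x, g x ∂(stdGaussianPi n) + l ^ 2 * L / 2 := by
  have hint := integrable_exp_mul_of_gradient_bound hg hpB
  have hset : ∀ l, l ∈ interior (integrableExpSet g (stdGaussianPi n)) := by
    have : integrableExpSet g (stdGaussianPi n) = Set.univ := Set.eq_univ_of_forall hint
    simp [this]
  have hd : ∀ l, HasDerivAt (fun l => cgf g (stdGaussianPi n) l -
      (l * ∫ x, g x ∂(stdGaussianPi n) + l ^ 2 * L / 2))
      ((∫ x, g x * exp (l * g x) ∂(stdGaussianPi n)) / mgf g (stdGaussianPi n) l -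
        (∫ x, g x ∂(stdGaussianPi n) + l * L)) l := by
    intro l
    refine HasDerivAt.sub ((hasDerivAt_mgf (hset l)).log (mgf_pos (hint l)).ne') ?_
    have h2 : HasDerivAt (fun l : ℝ => l ^ 2 * L / 2) (l * L) l := by
      convert! (((hasDerivAt_id' l).fun_pow 2).mul_const L).div_const 2 using 1
      simp
      ring
    simpa using ((hasDerivAt_id' l).mul_const (∫ x, g x ∂(stdGaussianPi n))).fun_add h2
  have hanti := antitoneOn_of_deriv_nonpos (convex_Ici (0 : ℝ))
    (fun l _ => (hd l).continuousAt.continuousWithinAt)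
    (fun l _ => (hd l).differentiableAt.differentiableWithinAt) (fun l hl => ?_)
  · have := hanti (Set.mem_Ici.2 le_rfl) hl hl
    simp at this
    linarith
  · rw [interior_Ici] at hl
    rw [(hd l).deriv, sub_nonpos, div_le_iff₀ (mgf_pos (hint l))]
    exact integral_mul_exp_le_stdGaussianPi hg hpc hpB hL (le_of_lt hl)

/-- Tsirelson's inequality: a smooth function with squared gradient norm at most `L` has
sub-Gaussian upper deviations from its mean under the standard Gaussian measure. -/
lemma measure_ge_integral_add_le_stdGaussianPi {n : ℕ} {g : (Fin n → ℝ) → ℝ}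
    {p : (Fin n → ℝ) → Fin n → ℝ} {B L : ℝ}
    (hg : ∀ x, HasFDerivAt g
      (∑ i, p x i • ContinuousLinearMap.proj (R := ℝ) (φ := fun _ : Fin n => ℝ) i) x)
    (hpc : Continuous p) (hpB : ∀ x i, |p x i| ≤ B) (hL : ∀ x y, ∑ i, p x i * p y i ≤ L)
    (hLpos : 0 < L) {r : ℝ} (hr : 0 ≤ r) :
    (stdGaussianPi n).real {x | ∫ y, g y ∂(stdGaussianPi n) + r ≤ g x} ≤
      exp (-r ^ 2 / (2 * L)) := by
  have hl : 0 ≤ r / L := by positivity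
  refine (measure_ge_le_exp_cgf _ hl
    (integrable_exp_mul_of_gradient_bound hg hpB _)).trans (exp_le_exp.2 ?_)
  refine (add_le_add_right (cgf_le_stdGaussianPi hg hpc hpB hL hl) _).trans (le_of_eq ?_)
  field_simp
  ring

lemma hasFDerivAt_log_mean_exp {n : ℕ} {μ : ℝ} (hμ : μ ≠ 0) {C : Finset (Finset (Fin n))}
    (hC : C.Nonempty) (x : Fin n → ℝ) :
    HasFDerivAt (fun x : Fin n → ℝ => (1 / μ) * Real.log ((1 / (C.card : ℝ)) *
        ∑ S ∈ C, Real.exp (μ * ∑ i ∈ S, x i)))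
      (∑ i, ((∑ S ∈ C, if i ∈ S then exp (μ * ∑ j ∈ S, x j) else 0) /
          ∑ S ∈ C, exp (μ * ∑ j ∈ S, x j)) •
        ContinuousLinearMap.proj (R := ℝ) (φ := fun _ : Fin n => ℝ) i) x := by
  have hpos : 0 < ∑ S ∈ C, exp (μ * ∑ j ∈ S, x j) := Finset.sum_pos (fun _ _ => exp_pos _) hC
  have hcard : (C.card : ℝ) ≠ 0 := by simpa using hC.ne_empty
  have h : HasFDerivAt (fun x : Fin n → ℝ => ∑ S ∈ C, Real.exp (μ * ∑ i ∈ S, x i))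
      (∑ S ∈ C, Real.exp (μ * ∑ i ∈ S, x i) • μ • ∑ i ∈ S,
        ContinuousLinearMap.proj (R := ℝ) (φ := fun _ : Fin n => ℝ) i) x :=
    HasFDerivAt.fun_sum fun S _ =>
      ((HasFDerivAt.fun_sum fun i _ => hasFDerivAt_apply i x).const_mul μ).exp
  have h' := ((h.const_mul (1 / (C.card : ℝ))).log (by positivity)).const_mul (1 / μ)
  convert! h' using 1
  ext v
  simp only [_root_.sum_apply, _root_.smul_apply, ContinuousLinearMap.proj_apply,
    smul_eq_mul]
  have e : ∑ S ∈ C, exp (μ * ∑ i ∈ S, x i) * (μ * ∑ i ∈ S, v i) =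
      μ * ∑ i, (∑ S ∈ C, if i ∈ S then exp (μ * ∑ j ∈ S, x j) else 0) * v i := by
    simp only [Finset.sum_mul, ite_mul, zero_mul]
    rw [Finset.sum_comm, Finset.mul_sum]
    refine Finset.sum_congr rfl fun S _ => ?_
    rw [Finset.sum_ite_mem, Finset.univ_inter, ← Finset.mul_sum]
    ring
  rw [e]
  simp only [div_mul_eq_mul_div, ← Finset.sum_div]
  field_simp

lemma sum_ite_mem_div_sum_mem_Icc {n : ℕ} {C : Finset (Finset (Fin n))} {w : Finset (Fin n) → ℝ}
    (hw : ∀ S, 0 ≤ w S) (i : Fin n) :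
    (∑ S ∈ C, if i ∈ S then w S else 0) / ∑ S ∈ C, w S ∈ Set.Icc (0 : ℝ) 1 := by
  refine ⟨div_nonneg (Finset.sum_nonneg fun S _ => ?_) (Finset.sum_nonneg fun S _ => hw S),
    div_le_one_of_le₀ (Finset.sum_le_sum fun S _ => ?_) (Finset.sum_nonneg fun S _ => hw S)⟩
  · split_ifs
    exacts [hw S, le_rfl]
  · split_ifs
    exacts [le_rfl, hw S]

lemma sum_sum_ite_mem_div_sum {n K : ℕ} {C : Finset (Finset (Fin n))}
    (hcard : ∀ S ∈ C, S.card = K) {w : Finset (Fin n) → ℝ} (hw : ∑ S ∈ C, w S ≠ 0) :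
    ∑ i, (∑ S ∈ C, if i ∈ S then w S else 0) / ∑ S ∈ C, w S = K := by
  rw [← Finset.sum_div, Finset.sum_comm, div_eq_iff hw, Finset.mul_sum]
  refine Finset.sum_congr rfl fun S hS => ?_
  rw [Finset.sum_ite_mem, Finset.univ_inter, Finset.sum_const, hcard S hS, nsmul_eq_mul]

/-- For the Bayes-optimal test, which rejects iff
`(1/N)∑_{S∈C} exp(μ X_S) > exp(Kμ²/2)`, the type I error satisfies
`P₀{f* = 1} ≤ exp(-(Kμ/2 - M_C(μ))²/(2K))` whenever `Kμ/2 ≥ M_C(μ)`, where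
`M_C(μ) = E₀[(1/μ)·log((1/N)∑_{S∈C} exp(μ X_S))]`; consequently, for
`δ ∈ (0,1)`, `P₀{f* = 1} ≤ δ` whenever `μ ≥ 2M_C(μ)/K + √((8/K)·log(1/δ))`. -/
theorem stmt19 (n K : ℕ) (hK : 0 < K) (μ δ : ℝ) (hμ : 0 < μ)
    (hδ : δ ∈ Set.Ioo (0:ℝ) 1)
    (C : Finset (Finset (Fin n))) (hC : C.Nonempty) (hcard : ∀ S ∈ C, S.card = K)
    (P₀ : Measure (Fin n → ℝ))
    (hP₀ : P₀ = Measure.pi fun _ : Fin n => gaussianReal 0 1)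
    (M : ℝ)
    (hM : M = ∫ x, (1/μ) * Real.log ((1 / (C.card : ℝ)) *
      ∑ S ∈ C, Real.exp (μ * ∑ i ∈ S, x i)) ∂P₀)
    (typeI : ℝ)
    (htypeI : typeI = (P₀ {x | (1 / (C.card : ℝ)) *
      ∑ S ∈ C, Real.exp (μ * ∑ i ∈ S, x i) > Real.exp (K * μ^2 / 2)}).toReal) :
    (M ≤ K * μ / 2 → typeI ≤ Real.exp (-(K * μ / 2 - M)^2 / (2 * K))) ∧
    (μ ≥ 2 * M / K + Real.sqrt ((8 / (K : ℝ)) * Real.log (1/δ)) → typeI ≤ δ) := by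
  subst hP₀ hM htypeI
  set g : (Fin n → ℝ) → ℝ := fun x => (1/μ) * Real.log ((1 / (C.card : ℝ)) *
    ∑ S ∈ C, Real.exp (μ * ∑ i ∈ S, x i)) with hgdef
  set M := ∫ x, g x ∂(stdGaussianPi n)
  have hKpos : (0 : ℝ) < K := by exact_mod_cast hK
  have hpos : ∀ x : Fin n → ℝ, 0 < ∑ S ∈ C, exp (μ * ∑ j ∈ S, x j) :=
    fun x => Finset.sum_pos (fun _ _ => exp_pos _) hC
  have hmem := fun (x : Fin n → ℝ) => sum_ite_mem_div_sum_mem_Icc (C := C)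
    (w := fun S => exp (μ * ∑ j ∈ S, x j)) (fun S => (exp_pos _).le)
  have hfirst : M ≤ K * μ / 2 → ((stdGaussianPi n) {x | (1 / (C.card : ℝ)) *
      ∑ S ∈ C, Real.exp (μ * ∑ i ∈ S, x i) > Real.exp (K * μ^2 / 2)}).toReal ≤
      Real.exp (-(K * μ / 2 - M)^2 / (2 * K)) := by
    intro hMle
    refine le_trans ?_ (measure_ge_integral_add_le_stdGaussianPi
      (hasFDerivAt_log_mean_exp hμ.ne' hC) (B := 1) (L := K) ?_ (fun x i => ?_) (fun x y => ?_)
      hKpos (sub_nonneg.2 hMle))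
    · refine measureReal_mono fun x hx => ?_
      have hlog := Real.log_le_log (exp_pos _) (le_of_lt hx)
      rw [Real.log_exp] at hlog
      change M + (K * μ / 2 - M) ≤ g x
      rw [add_sub_cancel, hgdef]
      simp only
      rw [one_div_mul_eq_div, le_div_iff₀ hμ]
      linarith
    · refine continuous_pi fun i => Continuous.div ?_ (by fun_prop) fun x => (hpos x).ne'
      refine continuous_finsetSum _ fun S _ => ?_
      split_ifs <;> fun_prop
    · exact abs_le.2 ⟨by linarith [(hmem x i).1], (hmem x i).2⟩
    · refine le_of_le_of_eq (Finset.sum_le_sum fun i _ => ?_)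
        (sum_sum_ite_mem_div_sum hcard (hpos x).ne')
      exact mul_le_of_le_one_right (hmem x i).1 (hmem y i).2
  refine ⟨hfirst, fun hge => ?_⟩
  have hlogpos : 0 ≤ Real.log (1 / δ) := Real.log_nonneg (by
    rw [le_div_iff₀ hδ.1]
    linarith [hδ.2])
  set s := Real.sqrt ((8 / (K : ℝ)) * Real.log (1/δ)) with hs
  have hs0 : 0 ≤ s := Real.sqrt_nonneg _
  have hs2 : s ^ 2 = (8 / (K : ℝ)) * Real.log (1/δ) := Real.sq_sqrt (by positivity)
  have hdiff : K * s / 2 ≤ K * μ / 2 - M := by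
    have := mul_le_mul_of_nonneg_left (show 2 * M / K + s ≤ μ from hge) hKpos.le
    rw [mul_add, mul_div_cancel₀ _ hKpos.ne'] at this
    linarith
  have hdiff0 : 0 ≤ K * s / 2 := by positivity
  refine (hfirst (by linarith)).trans ?_
  have hδexp : Real.exp (-(K * s / 2) ^ 2 / (2 * K)) = δ := by
    have : -(K * s / 2) ^ 2 / (2 * K) = Real.log δ := by
      have h1 : -(K * s / 2) ^ 2 / (2 * K) = -(K * s ^ 2) / 8 := by
        field_simp
        ring
      rw [h1, hs2, one_div, Real.log_inv]
      field_simp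
    rw [this, Real.exp_log hδ.1]
  refine le_of_le_of_eq (Real.exp_le_exp.2 ?_) hδexp
  gcongr
end
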